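/- arXiv:2212.03105 — 2 statements merged into one kernel-verified Lean document; each statement's English description precedes it below -/
import Mathlib

section
/- Let T be a theory based on intuitionistic logic with L(T) = IPC. If all of Visser's rules V_n are admissible in T, then the propositional admissible rules of T are exactly those of IPC, i.e. ⊢~_T = ⊢~_IPC on propositional formulas. -/
set_option autoImplicit false
set_option linter.unusedVariables false

/-! ## Propositional formulas, intuitionistic and classical propositional logic -/

/-- Formulas of propositional logic, with countably many propositional letters. -/
inductive PropForm : Type
  | var : ℕ → PropForm
  | bot : PropForm
  | top : PropForm
  | and : PropForm → PropForm → PropForm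
  | or : PropForm → PropForm → PropForm
  | imp : PropForm → PropForm → PropForm

namespace PropForm
/-- Negation is defined, as usual, by `¬A := A → ⊥`. -/
def neg (A : PropForm) : PropForm := A.imp .bot
end PropForm

/-- Substitution of propositional formulas for propositional letters;
it commutes with `⊥`, `⊤` and the connectives. -/
def substProp (s : ℕ → PropForm) : PropForm → PropForm
  | .var n => s n
  | .bot => .bot
  | .top => .top
  | .and A B => .and (substProp s A) (substProp s B)
  | .or A B => .or (substProp s A) (substProp s B)
  | .imp A B => .imp (substProp s A) (substProp s B)

/-- Natural deduction for (intuitionistic) propositional logic, with an additional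
set `Ax` of axioms (so that classical logic is obtained by adding excluded middle). -/
inductive PropProv (Ax : Set PropForm) : Set PropForm → PropForm → Prop
  | hyp {Γ : Set PropForm} {A} : A ∈ Γ → PropProv Ax Γ A
  | axm {Γ : Set PropForm} {A} : A ∈ Ax → PropProv Ax Γ A
  | topI {Γ : Set PropForm} : PropProv Ax Γ .top
  | botE {Γ : Set PropForm} {A : PropForm} : PropProv Ax Γ .bot → PropProv Ax Γ A
  | andI {Γ : Set PropForm} {A B : PropForm} : PropProv Ax Γ A → PropProv Ax Γ B → PropProv Ax Γ (A.and B)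
  | andE1 {Γ : Set PropForm} {A B : PropForm} : PropProv Ax Γ (A.and B) → PropProv Ax Γ A
  | andE2 {Γ : Set PropForm} {A B : PropForm} : PropProv Ax Γ (A.and B) → PropProv Ax Γ B
  | orI1 {Γ : Set PropForm} {A B : PropForm} : PropProv Ax Γ A → PropProv Ax Γ (A.or B)
  | orI2 {Γ : Set PropForm} {A B : PropForm} : PropProv Ax Γ B → PropProv Ax Γ (A.or B)
  | orE {Γ : Set PropForm} {A B C : PropForm} : PropProv Ax Γ (A.or B) → PropProv Ax (insert A Γ) C →
      PropProv Ax (insert B Γ) C → PropProv Ax Γ C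
  | impI {Γ : Set PropForm} {A B : PropForm} : PropProv Ax (insert A Γ) B → PropProv Ax Γ (A.imp B)
  | impE {Γ : Set PropForm} {A B : PropForm} : PropProv Ax Γ (A.imp B) → PropProv Ax Γ A → PropProv Ax Γ B

/-- The instances of the law of excluded middle. -/
def emAxioms : Set PropForm := {A | ∃ B : PropForm, A = B.or B.neg}

/-- Derivability in intuitionistic propositional logic `IPC`. -/
def IPCProv : Set PropForm → PropForm → Prop := PropProv ∅

/-- Derivability in classical propositional logic `CPC` (adding excluded middle). -/
def CPCProv : Set PropForm → PropForm → Prop := PropProv emAxioms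

/-- The theorems of `IPC`. -/
def IPCThms : Set PropForm := {A | IPCProv ∅ A}

/-- The theorems of `CPC`. -/
def CPCThms : Set PropForm := {A | CPCProv ∅ A}

/-- The rule `A / B` is admissible in `IPC`. -/
def AdmIPC (A B : PropForm) : Prop :=
  ∀ s : ℕ → PropForm, substProp s A ∈ IPCThms → substProp s B ∈ IPCThms

/-- Admissibility of the rule `A / B` in a propositional logic given as its set of theorems. -/
def AdmInLogic (L : Set PropForm) (A B : PropForm) : Prop :=
  ∀ s : ℕ → PropForm, substProp s A ∈ L → substProp s B ∈ L

/-- A propositional logic: a set of theorems closed under modus ponens and substitution. -/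
structure PropLogic where
  thms : Set PropForm
  mp_closed : ∀ {A B : PropForm}, A.imp B ∈ thms → A ∈ thms → B ∈ thms
  subst_closed : ∀ (s : ℕ → PropForm) {A : PropForm}, A ∈ thms → substProp s A ∈ thms

/-- An intermediate propositional logic: `IPC ⊆ J ⊆ CPC`. -/
def PropLogic.Intermediate (J : PropLogic) : Prop := IPCThms ⊆ J.thms ∧ J.thms ⊆ CPCThms

/-! ### Visser's rules -/

def bigAnd (l : List PropForm) : PropForm := l.foldr .and .top
def bigOr (l : List PropForm) : PropForm := l.foldr .or .bot

/-- The antecedent `⋀_{i=1}^n (A_i → B_i)` of Visser's rule `V_n`. -/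
def visserAnte (n : ℕ) (A : Fin (n+2) → PropForm) (B : Fin n → PropForm) : PropForm :=
  bigAnd (List.ofFn fun i : Fin n => (A (i.castLE (by omega))).imp (B i))

/-- The premise `(⋀_{i=1}^n (A_i → B_i) → (A_{n+1} ∨ A_{n+2})) ∨ C` of Visser's rule `V_n`. -/
def visserPrem (n : ℕ) (A : Fin (n+2) → PropForm) (B : Fin n → PropForm) (C : PropForm) :
    PropForm :=
  ((visserAnte n A B).imp ((A ⟨n, by omega⟩).or (A ⟨n+1, by omega⟩))).or C

/-- The conclusion `⋁_{j=1}^{n+2} (⋀_{i=1}^n (A_i → B_i) → A_j) ∨ C` of Visser's rule `V_n`. -/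
def visserConc (n : ℕ) (A : Fin (n+2) → PropForm) (B : Fin n → PropForm) (C : PropForm) :
    PropForm :=
  (bigOr (List.ofFn fun j : Fin (n+2) => (visserAnte n A B).imp (A j))).or C

/-! ## First-order formulas over a language of predicate symbols -/

/-- First-order formulas over a language `P`, where `P n` is the type of `n`-ary predicate
symbols; the terms are the variables `x_i` (represented by natural numbers). -/
inductive FOForm (P : ℕ → Type) : Type
  | pred : {n : ℕ} → P n → (Fin n → ℕ) → FOForm P
  | bot : FOForm P
  | top : FOForm P
  | and : FOForm P → FOForm P → FOForm P
  | or : FOForm P → FOForm P → FOForm P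
  | imp : FOForm P → FOForm P → FOForm P
  | all : ℕ → FOForm P → FOForm P
  | ex : ℕ → FOForm P → FOForm P

namespace FOForm
variable {P : ℕ → Type}

/-- Negation is defined by `¬A := A → ⊥`. -/
def neg (A : FOForm P) : FOForm P := A.imp .bot

/-- The free variables of a first-order formula. -/
def FV : FOForm P → Finset ℕ
  | .pred _ args => Finset.image args Finset.univ
  | .bot => ∅
  | .top => ∅
  | .and A B => A.FV ∪ B.FV
  | .or A B => A.FV ∪ B.FV
  | .imp A B => A.FV ∪ B.FV
  | .all x A => A.FV.erase x
  | .ex x A => A.FV.erase x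

/-- Rename the free occurrences of the variable `x` to `y`. -/
def renameFree (x y : ℕ) : FOForm P → FOForm P
  | .pred p args => .pred p (fun i => if args i = x then y else args i)
  | .bot => .bot
  | .top => .top
  | .and A B => .and (A.renameFree x y) (B.renameFree x y)
  | .or A B => .or (A.renameFree x y) (B.renameFree x y)
  | .imp A B => .imp (A.renameFree x y) (B.renameFree x y)
  | .all z A => if z = x then .all z A else .all z (A.renameFree x y)
  | .ex z A => if z = x then .ex z A else .ex z (A.renameFree x y)

/-- `y` is free for (substitutable for) `x`: no free occurrence of `x` lies in the scope
of a quantifier binding `y`. -/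
def freeFor (y x : ℕ) : FOForm P → Prop
  | .pred _ _ => True
  | .bot => True
  | .top => True
  | .and A B => freeFor y x A ∧ freeFor y x B
  | .or A B => freeFor y x A ∧ freeFor y x B
  | .imp A B => freeFor y x A ∧ freeFor y x B
  | .all z A => x ∉ (FOForm.all z A).FV ∨ (y ≠ z ∧ freeFor y x A)
  | .ex z A => x ∉ (FOForm.ex z A).FV ∨ (y ≠ z ∧ freeFor y x A)

end FOForm

/-- The language of pure first-order logic: countably many predicate symbols in every arity. -/
abbrev PureLang : ℕ → Type := fun _ => ℕ

/-- Formulas of pure first-order logic. -/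
abbrev LForm := FOForm PureLang

/-- A substitution from the formulas of first-order logic to the formulas of a theory in the
language `P`: it commutes with `⊥`, `⊤`, the connectives and the quantifiers, and (as it is
induced by an assignment sending each predicate symbol `R` to a formula whose number of free
variables is at most the arity of `R`) the free variables of the image of an atomic formula
`R(x_{i_1}, …, x_{i_n})` are among `x_{i_1}, …, x_{i_n}`. -/
structure FOSubst (P : ℕ → Type) where
  app : LForm → FOForm P
  map_bot : app .bot = .bot
  map_top : app .top = .top
  map_and : ∀ A B, app (A.and B) = (app A).and (app B)
  map_or : ∀ A B, app (A.or B) = (app A).or (app B)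
  map_imp : ∀ A B, app (A.imp B) = (app A).imp (app B)
  map_all : ∀ x A, app (.all x A) = .all x (app A)
  map_ex : ∀ x A, app (.ex x A) = .ex x (app A)
  fv_pred : ∀ {n : ℕ} (p : PureLang n) (args : Fin n → ℕ),
      (app (.pred p args)).FV ⊆ Finset.image args Finset.univ

/-- Substitution of formulas (of a theory in the language `P`) for propositional letters. -/
def substF {P : ℕ → Type} (s : ℕ → FOForm P) : PropForm → FOForm P
  | .var n => s n
  | .bot => .bot
  | .top => .top
  | .and A B => (substF s A).and (substF s B)
  | .or A B => (substF s A).or (substF s B)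
  | .imp A B => (substF s A).imp (substF s B)

/-- The admissibility relation `Γ ⊢~ Δ` of a theory with provability predicate `Pr`:
whenever all premises are provable under a substitution, so is one of the conclusions. -/
def FOAdm {P : ℕ → Type} (Pr : FOForm P → Prop) (Γ Δ : Finset LForm) : Prop :=
  ∀ σ : FOSubst P, (∀ A ∈ Γ, Pr (σ.app A)) → ∃ B ∈ Δ, Pr (σ.app B)

/-- `A` is a tautology of the theory: `⊤ ⊢~ A`. -/
def IsTautologyOf {P : ℕ → Type} (Pr : FOForm P → Prop) (A : LForm) : Prop :=
  FOAdm Pr {FOForm.top} {A}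

/-- `A` is a tautology of the theory, in the equivalent form `T ⊢ σ(A)` for all `σ`. -/
def FOTaut {P : ℕ → Type} (Pr : FOForm P → Prop) (A : LForm) : Prop :=
  ∀ σ : FOSubst P, Pr (σ.app A)

/-- The first-order logic `QL(T)` of a theory: all its first-order tautologies. -/
def QLogicOf {P : ℕ → Type} (Pr : FOForm P → Prop) : Set LForm := {A | FOTaut Pr A}

/-- The propositional logic `L(T)` of a theory: all its propositional tautologies.
(Propositional letters are nullary predicates, so they get substituted by sentences.) -/
def PLogicOf {P : ℕ → Type} (Pr : FOForm P → Prop) : Set PropForm :=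
  {A | ∀ s : ℕ → FOForm P, (∀ n, (s n).FV = ∅) → Pr (substF s A)}

/-- The propositional logic of a theory, defined with substitutions of arbitrary
`T`-formulas for propositional letters. -/
def PLogicOfF {P : ℕ → Type} (Pr : FOForm P → Prop) : Set PropForm :=
  {A | ∀ s : ℕ → FOForm P, Pr (substF s A)}

/-- The propositional rule `A / B` is admissible in the theory (substituting sentences). -/
def AdmThy {P : ℕ → Type} (Pr : FOForm P → Prop) (A B : PropForm) : Prop :=
  ∀ s : ℕ → FOForm P, (∀ n, (s n).FV = ∅) → Pr (substF s A) → Pr (substF s B)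

/-- The propositional rule `A / B` is admissible in the theory (substituting formulas). -/
def AdmThyF {P : ℕ → Type} (Pr : FOForm P → Prop) (A B : PropForm) : Prop :=
  ∀ s : ℕ → FOForm P, Pr (substF s A) → Pr (substF s B)

/-! ## Theories and prime theories -/

/-- A set of propositional formulas containing the theorems of `IPC` and closed under
modus ponens. -/
structure IsTheory (T : Set PropForm) : Prop where
  thms : IPCThms ⊆ T
  mp : ∀ {X Y : PropForm}, X.imp Y ∈ T → X ∈ T → Y ∈ T

/-- A consistent theory with the disjunction property. -/
structure IsPrimeTheory (T : Set PropForm) : Prop extends IsTheory T where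
  bot_notMem : PropForm.bot ∉ T
  or_mem : ∀ {X Y : PropForm}, X.or Y ∈ T → X ∈ T ∨ Y ∈ T

namespace IPCThms

variable (X Y Z : PropForm)

theorem top_mem : PropForm.top ∈ IPCThms := .topI

theorem bot_imp : PropForm.bot.imp X ∈ IPCThms := .impI (.botE (.hyp (by simp)))

theorem imp_self : X.imp X ∈ IPCThms := .impI (.hyp (by simp))

theorem imp_imp_left : X.imp (Y.imp X) ∈ IPCThms := .impI (.impI (.hyp (by simp)))

theorem imp_distrib : (X.imp (Y.imp Z)).imp ((X.imp Y).imp (X.imp Z)) ∈ IPCThms :=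
  .impI (.impI (.impI (.impE (A := Y) (.impE (A := X) (.hyp (by simp)) (.hyp (by simp)))
    (.impE (A := X) (.hyp (by simp)) (.hyp (by simp))))))

theorem imp_and : X.imp (Y.imp (X.and Y)) ∈ IPCThms :=
  .impI (.impI (.andI (.hyp (by simp)) (.hyp (by simp))))

theorem and_left : (X.and Y).imp X ∈ IPCThms := .impI (.andE1 (B := Y) (.hyp (by simp)))

theorem and_right : (X.and Y).imp Y ∈ IPCThms := .impI (.andE2 (A := X) (.hyp (by simp)))

theorem or_inl : X.imp (X.or Y) ∈ IPCThms := .impI (.orI1 (.hyp (by simp)))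

theorem or_inr : Y.imp (X.or Y) ∈ IPCThms := .impI (.orI2 (.hyp (by simp)))

theorem or_elim : (X.imp Z).imp ((Y.imp Z).imp ((X.or Y).imp Z)) ∈ IPCThms :=
  .impI (.impI (.impI (.orE (A := X) (B := Y) (.hyp (by simp))
    (.impE (A := X) (.hyp (by simp)) (.hyp (by simp)))
    (.impE (A := Y) (.hyp (by simp)) (.hyp (by simp))))))

theorem or_mp : ((X.imp Y).or Z).imp ((X.or Z).imp (Y.or Z)) ∈ IPCThms :=
  .impI (.impI (.orE (A := X.imp Y) (B := Z) (.hyp (by simp))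
    (.orE (A := X) (B := Z) (.hyp (by simp))
      (.orI1 (.impE (A := X) (.hyp (by simp)) (.hyp (by simp)))) (.orI2 (.hyp (by simp))))
    (.orI2 (.hyp (by simp)))))

theorem isTheory : IsTheory IPCThms := ⟨subset_rfl, fun h h' => .impE h h'⟩

end IPCThms

/-- Derivability is preserved by substitution. -/
theorem PropProv.subst (s : ℕ → PropForm) {Γ : Set PropForm} {X : PropForm}
    (h : PropProv ∅ Γ X) : PropProv ∅ (substProp s '' Γ) (substProp s X) := by
  induction h with
  | hyp h => exact .hyp (Set.mem_image_of_mem _ h)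
  | axm h => exact h.elim
  | topI => exact .topI
  | botE _ ih => exact .botE ih
  | andI _ _ ih ih' => exact .andI ih ih'
  | andE1 _ ih => exact .andE1 ih
  | andE2 _ ih => exact .andE2 ih
  | orI1 _ ih => exact .orI1 ih
  | orI2 _ ih => exact .orI2 ih
  | orE _ _ _ ih ih₁ ih₂ =>
    rw [Set.image_insert_eq] at ih₁ ih₂
    exact .orE ih ih₁ ih₂
  | impI _ ih =>
    rw [Set.image_insert_eq] at ih
    exact .impI ih
  | impE _ _ ih ih' => exact .impE ih ih'

theorem IPCThms.subst (s : ℕ → PropForm) {X : PropForm} (h : X ∈ IPCThms) :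
    substProp s X ∈ IPCThms := by
  have := PropProv.subst s h
  rwa [Set.image_empty] at this

theorem substProp_comp (s t : ℕ → PropForm) (X : PropForm) :
    substProp s (substProp t X) = substProp (fun n => substProp s (t n)) X := by
  induction X <;> simp_all [substProp]

theorem substF_comp {P : ℕ → Type} (s : ℕ → FOForm P) (t : ℕ → PropForm) (X : PropForm) :
    substF s (substProp t X) = substF (fun n => substF s (t n)) X := by
  induction X <;> simp_all [substProp, substF]

theorem FV_substF {P : ℕ → Type} {s : ℕ → FOForm P} (hs : ∀ n, (s n).FV = ∅) (X : PropForm) :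
    (substF s X).FV = ∅ := by
  induction X <;> simp_all [substF, FOForm.FV]

namespace IsTheory

variable {T : Set PropForm}

theorem and_mem (h : IsTheory T) {X Y : PropForm} : X.and Y ∈ T ↔ X ∈ T ∧ Y ∈ T :=
  ⟨fun hm => ⟨h.mp (h.thms (IPCThms.and_left X Y)) hm, h.mp (h.thms (IPCThms.and_right X Y)) hm⟩,
    fun hm => h.mp (h.mp (h.thms (IPCThms.imp_and X Y)) hm.1) hm.2⟩

theorem or_inl (h : IsTheory T) {X : PropForm} (Y : PropForm) (hX : X ∈ T) : X.or Y ∈ T :=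
  h.mp (h.thms (IPCThms.or_inl X Y)) hX

theorem or_inr (h : IsTheory T) {Y : PropForm} (X : PropForm) (hY : Y ∈ T) : X.or Y ∈ T :=
  h.mp (h.thms (IPCThms.or_inr X Y)) hY

theorem bigAnd_mem (h : IsTheory T) (l : List PropForm) : bigAnd l ∈ T ↔ ∀ X ∈ l, X ∈ T := by
  induction l with
  | nil => simpa [bigAnd] using h.thms IPCThms.top_mem
  | cons X l ih =>
    have : bigAnd (X :: l) = X.and (bigAnd l) := rfl
    rw [this, h.and_mem, ih]; simp

/-- The consequences of a theory together with a formula. -/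
theorem adjoin (h : IsTheory T) (X : PropForm) : IsTheory {Y | X.imp Y ∈ T} where
  thms Y hY := h.mp (h.thms (IPCThms.imp_imp_left Y X)) (h.thms hY)
  mp {Y Z} hYZ hY := h.mp (h.mp (h.thms (IPCThms.imp_distrib X Y Z)) hYZ) hY

theorem residual (h : IsTheory T) (E : PropForm) : IsTheory {Y | Y.or E ∈ T} where
  thms Y hY := h.or_inl E (h.thms hY)
  mp {Y Z} hYZ hY := h.mp (h.mp (h.thms (IPCThms.or_mp Y Z E)) hYZ) hY

theorem sUnion {c : Set (Set PropForm)} (hne : c.Nonempty) (hc : IsChain (· ⊆ ·) c)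
    (h : ∀ T ∈ c, IsTheory T) : IsTheory (⋃₀ c) where
  thms X hX := by
    obtain ⟨T, hT⟩ := hne
    exact ⟨T, hT, (h T hT).thms hX⟩
  mp := by
    rintro X Y ⟨T, hT, hXY⟩ ⟨U, hU, hX⟩
    rcases hc.total hT hU with hTU | hUT
    · exact ⟨U, hU, (h U hU).mp (hTU hXY) hX⟩
    · exact ⟨T, hT, (h T hT).mp hXY (hUT hX)⟩

end IsTheory

/-- Prime extensions inside a class of theories closed under unions of chains and under
residuals `{Y | Y ∨ E ∈ T}`. -/
theorem exists_maximal_prime (F : Set PropForm → Prop) (hF : ∀ T, F T → IsTheory T)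
    (hchain : ∀ c : Set (Set PropForm), c.Nonempty → IsChain (· ⊆ ·) c → (∀ T ∈ c, F T) →
      F (⋃₀ c))
    (hres : ∀ T E, F T → F {Y | Y.or E ∈ T})
    {I : Set PropForm} (hne : I.Nonempty) (hor : ∀ X ∈ I, ∀ Y ∈ I, X.or Y ∈ I)
    {T : Set PropForm} (hT : F T) (hdis : ∀ X ∈ T, X ∉ I) :
    ∃ x, T ⊆ x ∧ F x ∧ IsPrimeTheory x ∧ (∀ X ∈ x, X ∉ I) ∧
      ∀ y, F y → x ⊆ y → (∀ X ∈ y, X ∉ I) → y ⊆ x := by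
  obtain ⟨x, hTx, hmax⟩ := zorn_subset_nonempty {y | F y ∧ ∀ X ∈ y, X ∉ I}
    (fun c hc hch hcne => ⟨⋃₀ c, ⟨hchain c hcne hch fun T hT => (hc hT).1,
      fun X ⟨U, hU, hX⟩ => (hc hU).2 X hX⟩, fun s hs => Set.subset_sUnion_of_mem hs⟩)
    T ⟨hT, hdis⟩
  obtain ⟨hx, hxI⟩ := hmax.prop
  have key : ∀ y, F y → x ⊆ y → (∀ X ∈ y, X ∉ I) → y ⊆ x :=
    fun y hy hxy hyI => hmax.le_of_ge ⟨hy, hyI⟩ hxy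
  have hth := hF x hx
  have hmeet : ∀ D E, D.or E ∈ x → D ∉ x → ∃ G ∈ I, G.or E ∈ x := by
    intro D E hDE hD
    by_contra! hcon
    exact hD (key _ (hres x E hx) (fun Y hY => hth.or_inl E hY)
      (fun G hG hGI => hcon G hGI hG) hDE)
  have hcomm : ∀ {D E : PropForm}, D.or E ∈ x → E.or D ∈ x := fun {D E} h =>
    hth.mp (hth.mp (hth.mp (hth.thms (IPCThms.or_elim D E (E.or D)))
      (hth.thms (IPCThms.or_inr E D))) (hth.thms (IPCThms.or_inl E D))) h
  refine ⟨x, hTx, hx, ⟨hth, ?_, ?_⟩, hxI, key⟩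
  · intro hb
    obtain ⟨G, hG⟩ := hne
    exact hxI G (hth.mp (hth.thms (IPCThms.bot_imp G)) hb) hG
  · intro D E hDE
    by_contra! hcon
    obtain ⟨G, hG, hGE⟩ := hmeet D E hDE hcon.1
    obtain ⟨H, hH, hHG⟩ := hmeet E G (hcomm hGE) hcon.2
    exact hxI _ hHG (hor H hH G hG)

theorem IsTheory.exists_maximal_prime {T : Set PropForm} (hT : IsTheory T)
    {I : Set PropForm} (hne : I.Nonempty) (hor : ∀ X ∈ I, ∀ Y ∈ I, X.or Y ∈ I)
    (hdis : ∀ X ∈ T, X ∉ I) :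
    ∃ x, T ⊆ x ∧ IsPrimeTheory x ∧ (∀ X ∈ x, X ∉ I) ∧
      ∀ y, IsTheory y → x ⊆ y → (∀ X ∈ y, X ∉ I) → y ⊆ x := by
  obtain ⟨x, h₁, -, h₂⟩ := _root_.exists_maximal_prime IsTheory (fun _ h => h)
    (fun c hne hc h => IsTheory.sUnion hne hc h) (fun _ E h => h.residual E) hne hor hT hdis
  exact ⟨x, h₁, h₂⟩

theorem IsTheory.or_imp_mem {T : Set PropForm} (hT : IsTheory T) {X Y Z : PropForm}
    (hX : X.imp Z ∈ T) (hY : Y.imp Z ∈ T) : (X.or Y).imp Z ∈ T :=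
  hT.mp (hT.mp (hT.thms (IPCThms.or_elim X Y Z)) hX) hY

theorem IsTheory.exists_prime {T : Set PropForm} (hT : IsTheory T) {X : PropForm} (hX : X ∉ T) :
    ∃ x, IsPrimeTheory x ∧ T ⊆ x ∧ X ∉ x := by
  obtain ⟨x, hTx, hx, hI, -⟩ := hT.exists_maximal_prime (I := {Y | Y.imp X ∈ T})
    ⟨X, hT.thms (IPCThms.imp_self X)⟩ (fun _ hY _ hZ => hT.or_imp_mem hY hZ)
    (fun Y hY hYX => hX (hT.mp hYX hY))
  exact ⟨x, hx, hTx, fun h => hI X h (hT.thms (IPCThms.imp_self X))⟩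

theorem IsTheory.mem_iff {T : Set PropForm} (hT : IsTheory T) {X : PropForm} :
    X ∈ T ↔ ∀ x, IsPrimeTheory x → T ⊆ x → X ∈ x := by
  refine ⟨fun h x _ hTx => hTx h, fun h => ?_⟩
  by_contra hX
  obtain ⟨x, hx, hTx, hXx⟩ := hT.exists_prime hX
  exact hXx (h x hx hTx)

theorem IsTheory.imp_mem {T : Set PropForm} (hT : IsTheory T) {X Y : PropForm} :
    X.imp Y ∈ T ↔ ∀ x, IsPrimeTheory x → T ⊆ x → X ∈ x → Y ∈ x := by
  refine ⟨fun h x hx hTx hX => hx.mp (hTx h) hX, fun h => ?_⟩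
  refine (hT.adjoin X).mem_iff.2 fun x hx hTx => h x hx ?_ (hTx (hT.thms (IPCThms.imp_self X)))
  exact fun Z hZ => hTx (hT.mp (hT.thms (IPCThms.imp_imp_left Z X)) hZ)

namespace IsPrimeTheory

variable {x : Set PropForm}

theorem or_mem_iff (hx : IsPrimeTheory x) {X Y : PropForm} : X.or Y ∈ x ↔ X ∈ x ∨ Y ∈ x :=
  ⟨hx.or_mem, fun h => h.elim (hx.or_inl Y) (hx.or_inr X)⟩

theorem bigOr_mem (hx : IsPrimeTheory x) (l : List PropForm) :
    bigOr l ∈ x ↔ ∃ X ∈ l, X ∈ x := by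
  induction l with
  | nil => simpa [bigOr] using hx.bot_notMem
  | cons X l ih =>
    have : bigOr (X :: l) = X.or (bigOr l) := rfl
    rw [this, hx.or_mem_iff, ih]; simp

theorem preimage_substProp (hx : IsPrimeTheory x) (s : ℕ → PropForm) :
    IsPrimeTheory (substProp s ⁻¹' x) where
  thms X hX := hx.thms (IPCThms.subst s hX)
  mp hXY hX := hx.mp hXY hX
  bot_notMem := hx.bot_notMem
  or_mem h := hx.or_mem h

end IsPrimeTheory

/-! ## Theories closed under Visser's rules -/

/-- Closure under all of Visser's rules. -/
def VisserClosed (T : Set PropForm) : Prop :=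
  ∀ (n : ℕ) (A : Fin (n+2) → PropForm) (B : Fin n → PropForm) (C : PropForm),
    visserPrem n A B C ∈ T → visserConc n A B C ∈ T

theorem IsTheory.or_assoc_mem {T : Set PropForm} (hT : IsTheory T) {X Y Z : PropForm} :
    (X.or Y).or Z ∈ T ↔ X.or (Y.or Z) ∈ T := by
  rw [hT.mem_iff, hT.mem_iff]
  refine forall_congr' fun x => forall_congr' fun hx => forall_congr' fun _ => ?_
  simp only [hx.or_mem_iff, or_assoc]

/-- A Visser-closed theory omitting `B` extends to a Visser-closed prime theory omitting `B`. -/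
theorem exists_visserClosed_prime {T : Set PropForm} (hT : IsTheory T) (hV : VisserClosed T)
    {B : PropForm} (hB : B ∉ T) :
    ∃ x, T ⊆ x ∧ IsPrimeTheory x ∧ VisserClosed x ∧ B ∉ x := by
  obtain ⟨x, hTx, hFx, hx, hI, -⟩ := exists_maximal_prime
    (fun T => IsTheory T ∧ VisserClosed T) (fun _ h => h.1)
    (fun c hne hc h => ⟨IsTheory.sUnion hne hc fun T hT => (h T hT).1, by
      rintro n A B C ⟨U, hU, hp⟩
      exact ⟨U, hU, (h U hU).2 n A B C hp⟩⟩)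
    (fun U E h => ⟨h.1.residual E, fun n A B C hp =>
      h.1.or_assoc_mem.2 (h.2 n A B (C.or E) (h.1.or_assoc_mem.1 hp))⟩)
    (I := {Y | Y.imp B ∈ T}) ⟨B, hT.thms (IPCThms.imp_self B)⟩
    (fun _ hY _ hZ => hT.or_imp_mem hY hZ) ⟨hT, hV⟩ (fun Y hY hYB => hB (hT.mp hYB hY))
  exact ⟨x, hTx, hx, hFx.2, fun h => hI B h (hT.thms (IPCThms.imp_self B))⟩

/-- The conjunction of a list of implications. -/
def impConj (l : List (PropForm × PropForm)) : PropForm :=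
  bigAnd (l.map fun p => p.1.imp p.2)

theorem IsTheory.impConj_mem {T : Set PropForm} (hT : IsTheory T)
    (l : List (PropForm × PropForm)) : impConj l ∈ T ↔ ∀ p ∈ l, p.1.imp p.2 ∈ T := by
  simp only [impConj, hT.bigAnd_mem, List.forall_mem_map]

/-- Visser's rule for a prime theory, with two disjuncts in the consequent. -/
theorem VisserClosed.imp_or {x : Set PropForm} (hx : IsPrimeTheory x) (hV : VisserClosed x)
    (l : List (PropForm × PropForm)) {G H : PropForm} (h : (impConj l).imp (G.or H) ∈ x) :
    (∃ p ∈ l, (impConj l).imp p.1 ∈ x) ∨ (impConj l).imp G ∈ x ∨ (impConj l).imp H ∈ x := by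
  let A : Fin (l.length + 2) → PropForm := fun j =>
    if hj : j.1 < l.length then (l[j.1]).1 else if j.1 = l.length then G else H
  let B : Fin l.length → PropForm := fun i => (l[i.1]).2
  have hante : visserAnte l.length A B = impConj l := by
    unfold visserAnte impConj
    congr 1
    apply List.ext_getElem <;> simp [A, B]
  have hG : A ⟨l.length, by omega⟩ = G := by simp [A]
  have hH : A ⟨l.length + 1, by omega⟩ = H := by simp [A]
  have hp : visserPrem l.length A B .bot ∈ x := by
    unfold visserPrem
    rw [hante, hG, hH]
    exact hx.or_inl _ h
  have hc := hV _ _ _ _ hp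
  unfold visserConc at hc
  rw [hx.or_mem_iff, or_iff_left hx.bot_notMem, hx.bigOr_mem, hante] at hc
  obtain ⟨X, hX, hXx⟩ := hc
  rw [List.mem_ofFn] at hX
  obtain ⟨j, rfl⟩ := hX
  by_cases hj : j.1 < l.length
  · refine .inl ⟨l[j.1], List.getElem_mem hj, ?_⟩
    simpa [A, hj] using hXx
  · by_cases hj' : j.1 = l.length
    · exact .inr (.inl (by simpa [A, hj'] using hXx))
    · exact .inr (.inr (by simpa [A, hj, hj'] using hXx))

theorem VisserClosed.imp_bigOr {x : Set PropForm} (hx : IsPrimeTheory x) (hV : VisserClosed x)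
    (l : List (PropForm × PropForm)) (g : List PropForm) (h : (impConj l).imp (bigOr g) ∈ x) :
    (∃ p ∈ l, (impConj l).imp p.1 ∈ x) ∨ (∃ G ∈ g, (impConj l).imp G ∈ x) ∨
      (impConj l).imp .bot ∈ x := by
  induction g with
  | nil => exact .inr (.inr h)
  | cons G g ih =>
    rcases hV.imp_or hx l (G := G) (H := bigOr g) h with h | h | h
    · exact .inl h
    · exact .inr (.inl ⟨G, by simp, h⟩)
    · rcases ih h with h | ⟨G', hG', h⟩ | h
      · exact .inl h
      · exact .inr (.inl ⟨G', by simp [hG'], h⟩)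
      · exact .inr (.inr h)

/-- In the set of prime extensions of a Visser-closed prime theory, every family has a tight
predecessor. -/
theorem exists_tight_predecessor {Γ : Set PropForm} (hΓ : IsPrimeTheory Γ) (hV : VisserClosed Γ)
    (𝒟 : Set (Set PropForm)) (h𝒟 : ∀ d ∈ 𝒟, IsPrimeTheory d ∧ Γ ⊆ d) :
    ∃ Δ, IsPrimeTheory Δ ∧ Γ ⊆ Δ ∧ (∀ d ∈ 𝒟, Δ ⊆ d) ∧
      ∀ X Y : PropForm, (X ∈ Δ → Y ∈ Δ) → (∀ d ∈ 𝒟, X.imp Y ∈ d) → X.imp Y ∈ Δ := by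
  set Λ : Set PropForm := ⋂₀ 𝒟
  have hΛ : IsTheory Λ :=
    ⟨fun X hX d hd => (h𝒟 d hd).1.thms hX,
      fun hXY hX d hd => (h𝒟 d hd).1.mp (hXY d hd) (hX d hd)⟩
  have hΓΛ : Γ ⊆ Λ := fun X hX d hd => (h𝒟 d hd).2 hX
  let ok : List (PropForm × PropForm) → Prop := fun l => ∀ p ∈ l, p.1 ∉ Λ ∧ p.1.imp p.2 ∈ Λ
  let Θ : Set PropForm := {X | ∃ l, ok l ∧ (impConj l).imp X ∈ Γ}
  have hΓΘ : Γ ⊆ Θ := fun X hX =>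
    ⟨[], by simp [ok], hΓ.mp (hΓ.thms (IPCThms.imp_imp_left X _)) hX⟩
  have hΘ : IsTheory Θ := by
    refine ⟨hΓ.thms.trans hΓΘ, ?_⟩
    rintro X Y ⟨l, hl, hXY⟩ ⟨m, hm, hX⟩
    refine ⟨l ++ m, fun p hp => (List.mem_append.1 hp).elim (hl p) (hm p), ?_⟩
    refine hΓ.imp_mem.2 fun x hx hΓx hlm => ?_
    rw [hx.impConj_mem] at hlm
    refine hx.mp (hx.mp (hΓx hXY) ?_) (hx.mp (hΓx hX) ?_) <;> rw [hx.impConj_mem] <;>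
      exact fun p hp => hlm p (by simp [hp])
  let I : Set PropForm := {X | ∃ g : List PropForm, (∀ G ∈ g, G ∉ Λ) ∧ X.imp (bigOr g) ∈ IPCThms}
  have hdis : ∀ X ∈ Θ, X ∉ I := by
    rintro X ⟨l, hl, hX⟩ ⟨g, hg, hXg⟩
    have himp : (impConj l).imp (bigOr g) ∈ Γ := hΓ.imp_mem.2 fun x hx hΓx hlx =>
      hx.mp (hx.thms hXg) (hx.mp (hΓx hX) hlx)
    have hlΛ : impConj l ∈ Λ := (hΛ.impConj_mem l).2 fun p hp => (hl p hp).2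
    rcases hV.imp_bigOr hΓ l g himp with ⟨p, hp, h⟩ | ⟨G, hG, h⟩ | h
    · exact (hl p hp).1 (hΛ.mp (hΓΛ h) hlΛ)
    · exact hg G hG (hΛ.mp (hΓΛ h) hlΛ)
    · have hbot : ∀ Z, Z ∈ Λ := fun Z =>
        hΛ.mp (hΛ.thms (IPCThms.bot_imp Z)) (hΛ.mp (hΓΛ h) hlΛ)
      have hnil : l = [] := List.eq_nil_iff_forall_not_mem.2 fun p hp => (hl p hp).1 (hbot _)
      subst hnil
      exact hΓ.bot_notMem (hΓ.mp h (hΓ.thms IPCThms.top_mem))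
  have hmemI : ∀ G, G ∉ Λ → G ∈ I := fun G hG =>
    ⟨[G], by simpa using hG, IPCThms.or_inl G _⟩
  obtain ⟨Δ, hΘΔ, hΔ, hΔI, hmax⟩ := hΘ.exists_maximal_prime (I := I)
    ⟨.bot, [], by simp, IPCThms.imp_self _⟩
    (by
      rintro X ⟨g, hg, hX⟩ Y ⟨k, hk, hY⟩
      refine ⟨g ++ k, fun G hG => (List.mem_append.1 hG).elim (hg G) (hk G), ?_⟩
      refine IPCThms.isTheory.or_imp_mem ?_ ?_ <;>
        refine IPCThms.isTheory.imp_mem.2 fun x hx hTx hZ => (hx.bigOr_mem _).2 ?_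
      · obtain ⟨G, hG, hGx⟩ := (hx.bigOr_mem _).1 (hx.mp (hTx hX) hZ)
        exact ⟨G, by simp [hG], hGx⟩
      · obtain ⟨G, hG, hGx⟩ := (hx.bigOr_mem _).1 (hx.mp (hTx hY) hZ)
        exact ⟨G, by simp [hG], hGx⟩) hdis
  have hΔΛ : Δ ⊆ Λ := fun X hX => by
    by_contra hXΛ
    exact hΔI X hX (hmemI X hXΛ)
  have himpΔ : ∀ X Y, X ∉ Λ → X.imp Y ∈ Λ → X.imp Y ∈ Δ := fun X Y hX hXY =>
    hΘΔ ⟨[(X, Y)], by simpa [ok] using ⟨hX, hXY⟩, IPCThms.and_left _ _ |> hΓ.thms⟩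
  refine ⟨Δ, hΔ, hΓΘ.trans hΘΔ, fun d hd X hX => hΔΛ hX d hd, fun X Y hXY hΛXY => ?_⟩
  have hXYΛ : X.imp Y ∈ Λ := hΛXY
  by_cases hXΔ : X ∈ Δ
  · exact hΔ.mp (hΔ.thms (IPCThms.imp_imp_left Y X)) (hXY hXΔ)
  by_cases hXΛ : X ∈ Λ
  swap
  · exact himpΔ X Y hXΛ hXYΛ
  have hYΛ := hΛ.mp hXYΛ hXΛ
  obtain ⟨G, hXG, g, hg, hGg⟩ : ∃ G, X.imp G ∈ Δ ∧ G ∈ I := by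
    by_contra! hcon
    exact hXΔ (hmax _ (hΔ.adjoin X)
      (fun Z hZ => hΔ.mp (hΔ.thms (IPCThms.imp_imp_left Z X)) hZ) hcon
      (hΔ.thms (IPCThms.imp_self X)))
  refine hΔ.imp_mem.2 fun x hx hΔx hX => ?_
  obtain ⟨H, hH, hHx⟩ := (hx.bigOr_mem g).1 (hx.mp (hx.thms hGg) (hx.mp (hΔx hXG) hX))
  exact hx.mp (hΔx (himpΔ H Y (hg H hH)
    (hΛ.mp (hΛ.thms (IPCThms.imp_imp_left Y H)) hYΛ))) hHx

/-! ## Projective substitutions -/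

/-- The set of subformulas of a propositional formula. -/
def subforms : PropForm → Set PropForm
  | .var n => {.var n}
  | .bot => {.bot}
  | .top => {.top}
  | .and X Y => insert (.and X Y) (subforms X ∪ subforms Y)
  | .or X Y => insert (.or X Y) (subforms X ∪ subforms Y)
  | .imp X Y => insert (.imp X Y) (subforms X ∪ subforms Y)

theorem subforms_finite (X : PropForm) : (subforms X).Finite := by
  induction X <;> simp_all [subforms]

theorem self_mem_subforms (X : PropForm) : X ∈ subforms X := by
  cases X <;> simp [subforms]

theorem subforms_subset {X Y : PropForm} (h : X ∈ subforms Y) : subforms X ⊆ subforms Y := by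
  induction Y with
  | var n => rw [Set.mem_singleton_iff.1 h]
  | bot => rw [Set.mem_singleton_iff.1 h]
  | top => rw [Set.mem_singleton_iff.1 h]
  | and Y Z ihY ihZ | or Y Z ihY ihZ | imp Y Z ihY ihZ =>
    rcases h with rfl | h | h
    · exact subset_rfl
    · exact (ihY h).trans (Set.subset_union_left.trans (Set.subset_insert _ _))
    · exact (ihZ h).trans (Set.subset_union_right.trans (Set.subset_insert _ _))

theorem exists_conj {t : Set PropForm} (ht : t.Finite) :
    ∃ X, ∀ x, IsTheory x → (X ∈ x ↔ t ⊆ x) :=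
  ⟨bigAnd ht.toFinset.toList, fun x hx => by simp [hx.bigAnd_mem, Set.subset_def]⟩

theorem exists_disj {t : Set PropForm} (ht : t.Finite) :
    ∃ X, ∀ x, IsPrimeTheory x → (X ∈ x ↔ ∃ Y ∈ t, Y ∈ x) :=
  ⟨bigOr ht.toFinset.toList, fun x hx => by simp [hx.bigOr_mem]⟩

/-- The substitution `s` is the identity modulo `A`. -/
def IsProjectiveFor (A : PropForm) (s : ℕ → PropForm) : Prop :=
  ∀ x, IsPrimeTheory x → A ∈ x → ∀ X, substProp s X ∈ x ↔ X ∈ x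

theorem IsProjectiveFor.comp {A : PropForm} {s t : ℕ → PropForm} (hs : IsProjectiveFor A s)
    (ht : IsProjectiveFor A t) : IsProjectiveFor A fun n => substProp s (t n) :=
  fun x hx hA X => by rw [← substProp_comp, hs x hx hA, ht x hx hA]

theorem isProjectiveFor_of_var {A : PropForm} {s : ℕ → PropForm}
    (h : ∀ x, IsPrimeTheory x → A ∈ x → ∀ n, s n ∈ x ↔ PropForm.var n ∈ x) :
    IsProjectiveFor A s := by
  intro x hx hA X
  induction X generalizing x with
  | var n => exact h x hx hA n
  | bot => rfl
  | top => rfl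
  | and X Y ihX ihY => simp only [substProp, hx.and_mem, ihX x hx hA, ihY x hx hA]
  | or X Y ihX ihY => simp only [substProp, hx.or_mem_iff, ihX x hx hA, ihY x hx hA]
  | imp X Y ihX ihY =>
    simp only [substProp, hx.imp_mem]
    refine forall_congr' fun y => forall_congr' fun hy => forall_congr' fun hxy => ?_
    rw [ihX y hy (hxy hA), ihY y hy (hxy hA)]

open Classical in
/-- Ghilardi's substitution sending `p` to `A → p` for `p ∈ Δ` and to `A ∧ p` otherwise. -/
noncomputable def ghilardiSubst (A : PropForm) (Δ : Set PropForm) (n : ℕ) : PropForm :=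
  if PropForm.var n ∈ Δ then A.imp (.var n) else A.and (.var n)

theorem ghilardiSubst_isProjectiveFor (A : PropForm) (Δ : Set PropForm) :
    IsProjectiveFor A (ghilardiSubst A Δ) := by
  refine isProjectiveFor_of_var fun x hx hA n => ?_
  unfold ghilardiSubst
  split_ifs
  · exact ⟨fun h => hx.mp h hA, fun h => hx.mp (hx.thms (IPCThms.imp_imp_left _ _)) h⟩
  · simp [hx.and_mem, hA]

/-- The traces on `S` of the points above `x` that satisfy `A` after the substitution `s`. -/
def traces (A : PropForm) (S : Set PropForm) (s : ℕ → PropForm) (x : Set PropForm) :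
    Set (Set PropForm) :=
  {t | ∃ y, IsPrimeTheory y ∧ x ⊆ y ∧ substProp s A ∈ y ∧ t = substProp s ⁻¹' y ∩ S}

theorem traces_anti {A : PropForm} {S : Set PropForm} {s : ℕ → PropForm} {x y : Set PropForm}
    (h : x ⊆ y) : traces A S s y ⊆ traces A S s x :=
  fun _ ⟨z, hz, hyz, hA, ht⟩ => ⟨z, hz, h.trans hyz, hA, ht⟩

theorem substProp_comp_mem {A : PropForm} {s t : ℕ → PropForm} (ht : IsProjectiveFor A t)
    {x : Set PropForm} (hx : IsPrimeTheory x) (hA : substProp s A ∈ x) (X : PropForm) :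
    substProp (fun n => substProp s (t n)) X ∈ x ↔ substProp s X ∈ x := by
  rw [← substProp_comp]
  exact ht _ (hx.preimage_substProp s) hA X

theorem traces_subset_comp {A : PropForm} {S : Set PropForm} {s t : ℕ → PropForm}
    (ht : IsProjectiveFor A t) (x : Set PropForm) :
    traces A S s x ⊆ traces A S (fun n => substProp s (t n)) x := by
  rintro _ ⟨y, hy, hxy, hA, rfl⟩
  refine ⟨y, hy, hxy, (substProp_comp_mem ht hy hA A).2 hA, ?_⟩
  ext X
  simp only [Set.mem_inter_iff, Set.mem_preimage, substProp_comp_mem ht hy hA X]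

/-- If all points above `x` refuting `A` have the same traces `𝒮`, then after Ghilardi's
substitution for a tight predecessor `Δ` of the family of theories with traces in `𝒮` these points
have the same trace as `Δ`. -/
theorem ghilardiSubst_mem_iff {A : PropForm} {S : Set PropForm}
    (hS : ∀ X ∈ S, subforms X ⊆ S) {s : ℕ → PropForm} {𝒮 : Set (Set PropForm)}
    {𝒟 : Set (Set PropForm)} (h𝒟 : ∀ d ∈ 𝒟, IsPrimeTheory d ∧ d ∩ S ∈ 𝒮)
    (h𝒮 : ∀ y, IsPrimeTheory y → A ∈ y → y ∩ S ∈ 𝒮 → ∃ d ∈ 𝒟, d ∩ S = y ∩ S)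
    {Δ : Set PropForm} (hΔ : IsPrimeTheory Δ) (hΔ𝒟 : ∀ d ∈ 𝒟, Δ ⊆ d)
    (htight : ∀ X Y : PropForm, (X ∈ Δ → Y ∈ Δ) → (∀ d ∈ 𝒟, X.imp Y ∈ d) → X.imp Y ∈ Δ)
    {x : Set PropForm}
    (hx𝒮 : ∀ y, IsPrimeTheory y → x ⊆ y → substProp s A ∉ y → traces A S s y = 𝒮)
    {y : Set PropForm} (hy : IsPrimeTheory y) (hxy : x ⊆ y) (hA : substProp s A ∉ y)
    {X : PropForm} (hX : X ∈ S) :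
    substProp (fun n => substProp s (ghilardiSubst A Δ n)) X ∈ y ↔ X ∈ Δ := by
  have hproj := ghilardiSubst_isProjectiveFor A Δ
  have above : ∀ {y z}, IsPrimeTheory y → x ⊆ y → substProp s A ∉ y → IsPrimeTheory z → y ⊆ z →
      substProp s A ∈ z → ∃ d ∈ 𝒟, ∀ Y ∈ S, Y ∈ d ↔ substProp s Y ∈ z := by
    intro y z hy hxy hA hz hyz hAz
    obtain ⟨d, hd, hdz⟩ := h𝒮 _ (hz.preimage_substProp s) hAz
      (hx𝒮 y hy hxy hA ▸ ⟨z, hz, hyz, hAz, rfl⟩)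
    refine ⟨d, hd, fun Y hY => ?_⟩
    have := Set.ext_iff.1 hdz Y
    simpa [hY] using this
  induction X generalizing y with
  | var n =>
    simp only [substProp, ghilardiSubst]
    split_ifs with hn
    · simp only [hn, iff_true, substProp, hy.imp_mem]
      intro z hz hyz hAz
      obtain ⟨d, hd, hdz⟩ := above hy hxy hA hz hyz hAz
      exact (hdz _ hX).1 (hΔ𝒟 d hd hn)
    · simp [substProp, hy.and_mem, hA, hn]
  | bot => exact iff_of_false hy.bot_notMem hΔ.bot_notMem
  | top => exact iff_of_true (hy.thms IPCThms.top_mem) (hΔ.thms IPCThms.top_mem)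
  | and X Y ihX ihY =>
    have hXS : X ∈ S := hS _ hX (by simp [subforms, self_mem_subforms])
    have hYS : Y ∈ S := hS _ hX (by simp [subforms, self_mem_subforms])
    simp only [substProp, hy.and_mem, hΔ.and_mem, ihX hy hxy hA hXS, ihY hy hxy hA hYS]
  | or X Y ihX ihY =>
    have hXS : X ∈ S := hS _ hX (by simp [subforms, self_mem_subforms])
    have hYS : Y ∈ S := hS _ hX (by simp [subforms, self_mem_subforms])
    simp only [substProp, hy.or_mem_iff, hΔ.or_mem_iff, ihX hy hxy hA hXS, ihY hy hxy hA hYS]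
  | imp X Y ihX ihY =>
    have hXS : X ∈ S := hS _ hX (by simp [subforms, self_mem_subforms])
    have hYS : Y ∈ S := hS _ hX (by simp [subforms, self_mem_subforms])
    constructor
    · intro h
      refine htight X Y (fun hXΔ => ?_) fun d hd => ?_
      · exact (ihY hy hxy hA hYS).1 (hy.mp h ((ihX hy hxy hA hXS).2 hXΔ))
      · obtain ⟨z, hz, hyz, hAz, hdz⟩ : d ∩ S ∈ traces A S s y :=
          hx𝒮 y hy hxy hA ▸ (h𝒟 d hd).2
        have hmem : X.imp Y ∈ substProp s ⁻¹' z ∩ S :=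
          ⟨(substProp_comp_mem hproj hz hAz _).1 (hyz h), hX⟩
        exact (hdz ▸ hmem).1
    · intro h
      refine hy.imp_mem.2 fun z hz hyz hXz => ?_
      by_cases hAz : substProp s A ∈ z
      · obtain ⟨d, hd, hdz⟩ := above hy hxy hA hz hyz hAz
        rw [substProp_comp_mem hproj hz hAz] at hXz ⊢
        exact (hdz Y hYS).1 ((h𝒟 d hd).1.mp (hΔ𝒟 d hd h) ((hdz X hXS).2 hXz))
      · exact (ihY hz (hxy.trans hyz) hAz hYS).2
          (hΔ.mp h ((ihX hz (hxy.trans hyz) hAz hXS).1 hXz))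

/-- Every formula of a Visser-closed prime theory follows from a projective formula of that
theory. -/
theorem exists_projective {Γ : Set PropForm} (hΓ : IsPrimeTheory Γ) (hV : VisserClosed Γ)
    {A : PropForm} (hA : A ∈ Γ) :
    ∃ A₀ ∈ Γ, ∃ s, IsProjectiveFor A₀ s ∧ substProp s A₀ ∈ IPCThms ∧ A₀.imp A ∈ IPCThms := by
  set S := subforms A
  have hSfin : S.Finite := subforms_finite A
  have hsub : ∀ X ∈ S, subforms X ⊆ S := fun X hX => subforms_subset hX
  have hconj : ∀ t : Set PropForm, ∃ X, t ⊆ S → ∀ x, IsTheory x → (X ∈ x ↔ t ⊆ x) := fun t => by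
    by_cases ht : t ⊆ S
    · obtain ⟨X, hX⟩ := exists_conj (hSfin.subset ht)
      exact ⟨X, fun _ => hX⟩
    · exact ⟨.top, fun h => (ht h).elim⟩
  choose conj hconj using hconj
  have hdisj : ∀ t : Set PropForm, ∃ X, ∀ x, IsPrimeTheory x →
      (X ∈ x ↔ ∃ Y ∈ S \ t, Y ∈ x) := fun t => exists_disj (hSfin.subset Set.sdiff_subset)
  choose disj hdisj using hdisj
  let F : Set PropForm := insert A ((fun t => (conj t).imp (disj t)) '' 𝒫 S ∩ Γ)
  have hFfin : F.Finite := ((hSfin.finite_subsets.image _).inter_of_left Γ).insert A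
  obtain ⟨A₀, hA₀⟩ := exists_conj hFfin
  have hFΓ : F ⊆ Γ := Set.insert_subset hA Set.inter_subset_right
  have realize : ∀ y, IsPrimeTheory y → A₀ ∈ y →
      ∃ d, IsPrimeTheory d ∧ Γ ⊆ d ∧ d ∩ S = y ∩ S := by
    intro y hy hAy
    have ht : y ∩ S ⊆ S := Set.inter_subset_right
    have hnot : (conj (y ∩ S)).imp (disj (y ∩ S)) ∉ Γ := fun hf => by
      have hfy := (hA₀ y hy.toIsTheory).1 hAy (.inr ⟨⟨_, ht, rfl⟩, hf⟩)
      obtain ⟨Y, hY, hYy⟩ := (hdisj _ y hy).1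
        (hy.mp hfy ((hconj _ ht y hy.toIsTheory).2 Set.inter_subset_left))
      exact hY.2 ⟨hYy, hY.1⟩
    rw [hΓ.imp_mem] at hnot
    push Not at hnot
    obtain ⟨d, hd, hΓd, hc, hdj⟩ := hnot
    refine ⟨d, hd, hΓd, Set.Subset.antisymm (fun Y hY => ⟨?_, hY.2⟩)
      fun Y hY => ⟨(hconj _ ht d hd.toIsTheory).1 hc hY, hY.2⟩⟩
    by_contra hYy
    exact hdj ((hdisj _ d hd).2 ⟨Y, ⟨hY.2, fun h => hYy h.1⟩, hY.1⟩)
  have main : ∀ D : Finset (Set (Set PropForm)), IsLowerSet (D : Set (Set (Set PropForm))) →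
      ∃ s, IsProjectiveFor A₀ s ∧
        ∀ x, IsPrimeTheory x → substProp s A₀ ∉ x → traces A₀ S s x ∉ D := by
    intro D
    induction D using Finset.strongInduction with
    | H D ih =>
    intro hD
    rcases D.eq_empty_or_nonempty with rfl | hne
    · exact ⟨.var, isProjectiveFor_of_var fun _ _ _ _ => Iff.rfl, by simp⟩
    obtain ⟨𝒮, h𝒮⟩ := D.exists_maximal hne
    classical
    have hlow : IsLowerSet ((D.erase 𝒮 : Finset _) : Set (Set (Set PropForm))) := by
      intro a b hba ha
      have ha' := Finset.mem_erase.1 (Finset.mem_coe.1 ha)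
      refine Finset.mem_coe.2 (Finset.mem_erase.2 ⟨?_, hD hba ha'.2⟩)
      rintro rfl
      exact ha'.1 (le_antisymm (h𝒮.le_of_ge ha'.2 hba) hba)
    obtain ⟨s, hs, hsD⟩ := ih _ (Finset.erase_ssubset h𝒮.prop) hlow
    let 𝒟 : Set (Set PropForm) := {d | IsPrimeTheory d ∧ Γ ⊆ d ∧ d ∩ S ∈ 𝒮}
    obtain ⟨Δ, hΔ, hΓΔ, hΔ𝒟, htight⟩ := exists_tight_predecessor hΓ hV 𝒟
      fun d hd => ⟨hd.1, hd.2.1⟩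
    have hproj := ghilardiSubst_isProjectiveFor A₀ Δ
    refine ⟨_, hs.comp hproj, fun x hx hAx hmem => hAx ?_⟩
    have hAx' : substProp s A₀ ∉ x := fun h => hAx ((substProp_comp_mem hproj hx h A₀).2 h)
    have hx𝒮 : ∀ y, IsPrimeTheory y → x ⊆ y → substProp s A₀ ∉ y → traces A₀ S s y = 𝒮 := by
      intro y hy hxy hAy
      have hyD : traces A₀ S s y ∈ D :=
        hD ((traces_anti hxy).trans (traces_subset_comp hproj x)) hmem
      by_contra hne
      exact hsD y hy hAy (Finset.mem_erase.2 ⟨hne, hyD⟩)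
    have key : ∀ {y}, IsPrimeTheory y → x ⊆ y → substProp s A₀ ∉ y → ∀ {X}, X ∈ S →
        (substProp (fun n => substProp s (ghilardiSubst A₀ Δ n)) X ∈ y ↔ X ∈ Δ) :=
      fun hy hxy hAy _ hX => ghilardiSubst_mem_iff hsub (fun d hd => ⟨hd.1, hd.2.2⟩)
        (fun y hy hAy hyS => by
          obtain ⟨d, hd, hΓd, hdy⟩ := realize y hy hAy
          exact ⟨d, ⟨hd, hΓd, hdy ▸ hyS⟩, hdy⟩) hΔ hΔ𝒟 htight hx𝒮 hy hxy hAy hX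
    have hpre := fun {z} (hz : IsPrimeTheory z) =>
      hz.preimage_substProp fun n => substProp s (ghilardiSubst A₀ Δ n)
    refine (hA₀ _ (hpre hx).toIsTheory).2 ?_
    rintro f (rfl | ⟨⟨t, ht, rfl⟩, hf⟩)
    · exact (key hx subset_rfl hAx' (self_mem_subforms _)).2 (hΓΔ hA)
    refine hx.imp_mem.2 fun z hz hxz hcz => ?_
    by_cases hAz : substProp s A₀ ∈ z
    · rw [substProp_comp_mem hproj hz hAz] at hcz ⊢
      have hfz := (hA₀ _ (hz.preimage_substProp s).toIsTheory).1 hAz (.inr ⟨⟨t, ht, rfl⟩, hf⟩)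
      exact (hz.preimage_substProp s).mp hfz hcz
    · have htz := (hconj t ht _ (hpre hz).toIsTheory).1 hcz
      have htΔ : t ⊆ Δ := fun Y hY => (key hz hxz hAz (ht hY)).1 (htz hY)
      obtain ⟨Y, hY, hYΔ⟩ := (hdisj t Δ hΔ).1
        (hΔ.mp (hΓΔ hf) ((hconj t ht Δ hΔ.toIsTheory).2 htΔ))
      exact (hdisj t _ (hpre hz)).2 ⟨Y, hY, (key hz hxz hAz hY.1).2 hYΔ⟩
  have hfin : (𝒫 (𝒫 S)).Finite := hSfin.finite_subsets.finite_subsets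
  obtain ⟨s, hs, hsD⟩ := main hfin.toFinset
    (by
      rw [Set.Finite.coe_toFinset]
      exact fun a b hba ha => Set.Subset.trans hba ha)
  refine ⟨A₀, (hA₀ Γ hΓ.toIsTheory).2 hFΓ, s, hs, ?_, ?_⟩
  · refine IPCThms.isTheory.mem_iff.2 fun x hx _ => ?_
    by_contra hAx
    refine hsD x hx hAx (hfin.mem_toFinset.2 ?_)
    rintro _ ⟨y, -, -, -, rfl⟩
    exact Set.inter_subset_right
  · exact IPCThms.isTheory.imp_mem.2 fun x hx _ h =>
      (hA₀ x hx.toIsTheory).1 h (Set.mem_insert _ _)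

/-- Iemhoff's theorem: the admissible rules of `IPC` preserve membership in every theory closed
under Visser's rules. -/
theorem AdmIPC.mem_of_visserClosed {A B : PropForm} (h : AdmIPC A B) {T : Set PropForm}
    (hT : IsTheory T) (hV : VisserClosed T) (hA : A ∈ T) : B ∈ T := by
  by_contra hB
  obtain ⟨Γ, hTΓ, hΓ, hVΓ, hBΓ⟩ := exists_visserClosed_prime hT hV hB
  obtain ⟨A₀, hA₀, s, hs, hsA₀, himp⟩ := exists_projective hΓ hVΓ (hTΓ hA)
  have hsA : substProp s A ∈ IPCThms := IPCThms.isTheory.mp (IPCThms.subst s himp) hsA₀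
  exact hBΓ ((hs Γ hΓ hA₀ B).1 (hΓ.thms (h s hsA)))

/-- Let `T` be a theory based on intuitionistic logic (its provability is
closed under modus ponens and contains all substitution instances of `IPC`-theorems) with
`L(T) = IPC`. If all of Visser's rules `V_n` are admissible in `T`, then the propositional
admissible rules of `T` are exactly those of `IPC`. -/
theorem admissible_rules_eq_IPC_of_visser_admissible {P : ℕ → Type} (Pr : FOForm P → Prop)
    (hmp : ∀ A B : FOForm P, Pr (A.imp B) → Pr A → Pr B)
    (hipc : ∀ A ∈ IPCThms, ∀ s : ℕ → FOForm P, Pr (substF s A))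
    (hL : PLogicOf Pr = IPCThms)
    (hV : ∀ (n : ℕ) (A : Fin (n+2) → PropForm) (B : Fin n → PropForm) (C : PropForm),
        AdmThy Pr (visserPrem n A B C) (visserConc n A B C)) :
    ∀ A B : PropForm, AdmThy Pr A B ↔ AdmIPC A B := by
  intro A B
  constructor
  · intro h s hA
    rw [← hL] at hA ⊢
    intro t ht
    have := hA t ht
    rw [substF_comp] at this ⊢
    exact h _ (fun n => FV_substF ht (s n)) this
  · intro h s hs hA
    exact h.mem_of_visserClosed (T := {X | Pr (substF s X)})
      ⟨fun X hX => hipc X hX s, fun hXY hX => hmp _ _ hXY hX⟩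
      (fun n A B C hp => hV n A B C s hs hp) hA
end

section
/- If T is an extensible set theory (based on intuitionistic logic), then T has the disjunction property: whenever T ⊢ φ ∨ ψ, then T ⊢ φ or T ⊢ ψ. -/
set_option autoImplicit false
set_option linter.unusedVariables false

/-! ## The language of set theory and Kripke models of set theory -/

/-- Formulas in the language of set theory: a binary membership relation `∈`,
equality `=`, and the intuitionistic connectives and quantifiers
(`¬A` is defined as `A → ⊥`); variables are represented by natural numbers. -/
inductive ZFForm : Type
  | mem : ℕ → ℕ → ZFForm
  | eq : ℕ → ℕ → ZFForm
  | bot : ZFForm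
  | top : ZFForm
  | and : ZFForm → ZFForm → ZFForm
  | or : ZFForm → ZFForm → ZFForm
  | imp : ZFForm → ZFForm → ZFForm
  | all : ℕ → ZFForm → ZFForm
  | ex : ℕ → ZFForm → ZFForm

namespace ZFForm

/-- Negation: `¬A := A → ⊥`. -/
def neg (A : ZFForm) : ZFForm := A.imp .bot

/-- Biconditional: `A ↔ B := (A → B) ∧ (B → A)`. -/
def biimp (A B : ZFForm) : ZFForm := (A.imp B).and (B.imp A)

/-- The free variables of a set-theoretic formula. -/
def FV : ZFForm → Finset ℕ
  | .mem i j => {i, j}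
  | .eq i j => {i, j}
  | .bot => ∅
  | .top => ∅
  | .and A B => A.FV ∪ B.FV
  | .or A B => A.FV ∪ B.FV
  | .imp A B => A.FV ∪ B.FV
  | .all x A => A.FV.erase x
  | .ex x A => A.FV.erase x

/-- A sentence is a formula without free variables. -/
def IsSentence (A : ZFForm) : Prop := A.FV = ∅

end ZFForm

/-- A Kripke model for set theory: a partial order `(K, ≤)` of worlds, a (nonempty) domain
`Dom v` for every world, transition functions `tr : Dom v → Dom w` for `v ≤ w` (functorial),
and interpretations `mem v` of the membership relation that are preserved by the transition
functions; equality is interpreted as actual equality of domain elements. -/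
structure SetKripkeModel where
  World : Type
  le : World → World → Prop
  le_refl : ∀ w, le w w
  le_trans : ∀ {u v w}, le u v → le v w → le u w
  le_antisymm : ∀ {u v}, le u v → le v u → u = v
  Dom : World → Type
  dne : ∀ w, Nonempty (Dom w)
  tr : ∀ {v w}, le v w → Dom v → Dom w
  tr_refl : ∀ (v) (h : le v v) (x : Dom v), tr h x = x
  tr_trans : ∀ {u v w} (h1 : le u v) (h2 : le v w) (h3 : le u w) (x : Dom u),
      tr h2 (tr h1 x) = tr h3 x
  mem : ∀ w, Dom w → Dom w → Prop
  mem_mono : ∀ {v w} (h : le v w) (x y : Dom v), mem v x y → mem w (tr h x) (tr h y)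

/-- The forcing relation of a Kripke model of set theory. -/
def zforce (M : SetKripkeModel) : ZFForm → (v : M.World) → (ℕ → M.Dom v) → Prop
  | .mem i j, v, ρ => M.mem v (ρ i) (ρ j)
  | .eq i j, v, ρ => ρ i = ρ j
  | .bot, _, _ => False
  | .top, _, _ => True
  | .and A B, v, ρ => zforce M A v ρ ∧ zforce M B v ρ
  | .or A B, v, ρ => zforce M A v ρ ∨ zforce M B v ρ
  | .imp A B, v, ρ => ∀ (w : M.World) (h : M.le v w),
      zforce M A w (fun n => M.tr h (ρ n)) → zforce M B w (fun n => M.tr h (ρ n))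
  | .all x A, v, ρ => ∀ (w : M.World) (h : M.le v w) (d : M.Dom w),
      zforce M A w (Function.update (fun n => M.tr h (ρ n)) x d)
  | .ex x A, v, ρ => ∃ d : M.Dom v, zforce M A v (Function.update ρ x d)

/-- `M ⊩ φ`: the formula is forced at every world (under every assignment). -/
def Forces (M : SetKripkeModel) (φ : ZFForm) : Prop :=
  ∀ (v : M.World) (ρ : ℕ → M.Dom v), zforce M φ v ρ

/-- The data needed to extend a Kripke model of set theory with a new root `r` below all
worlds: a domain for the root, a membership relation on it, and transition functions to the
old domains, compatibly with the old transition functions and preserving membership.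
The resulting model `E.toModel` is based on the frame `K⁺` and restricts to `M` on `K`. -/
structure RootExtension (M : SetKripkeModel) where
  RDom : Type
  rdne : Nonempty RDom
  rmem : RDom → RDom → Prop
  rtr : (v : M.World) → RDom → M.Dom v
  rtr_compat : ∀ {v w : M.World} (h : M.le v w) (x : RDom), M.tr h (rtr v x) = rtr w x
  rmem_mono : ∀ (v : M.World) (x y : RDom), rmem x y → M.mem v (rtr v x) (rtr v y)

namespace RootExtension

variable {M : SetKripkeModel}

/-- The order on `K⁺ = K ∪ {r}`; `none` is the new root `r`. -/
def optLe (M : SetKripkeModel) : Option M.World → Option M.World → Prop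
  | none, _ => True
  | some _, none => False
  | some v, some w => M.le v w

/-- The domains of the extended model. -/
def Dom' (E : RootExtension M) : Option M.World → Type
  | none => E.RDom
  | some v => M.Dom v

/-- The transition functions of the extended model. -/
def tr' (E : RootExtension M) :
    ∀ {a b : Option M.World}, optLe M a b → E.Dom' a → E.Dom' b
  | none, none, _, x => x
  | none, some v, _, x => E.rtr v x
  | some _, none, h, _ => h.elim
  | some _, some _, h, x => M.tr h x

/-- The membership relations of the extended model. -/
def mem' (E : RootExtension M) : (a : Option M.World) → E.Dom' a → E.Dom' a → Prop
  | none => E.rmem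
  | some v => M.mem v

/-- The extended model `M⁺`, based on the frame `K⁺` obtained by adding a new root,
which restricts to `M` on `K`. -/
def toModel (E : RootExtension M) : SetKripkeModel where
  World := Option M.World
  le := optLe M
  le_refl := fun a => by cases a with
    | none => trivial
    | some v => exact M.le_refl v
  le_trans := by
    intro a b c h1 h2
    cases a with
    | none => trivial
    | some v =>
      cases b with
      | none => exact h1.elim
      | some w =>
        cases c with
        | none => exact h2.elim
        | some u => exact M.le_trans h1 h2
  le_antisymm := by
    intro a b h1 h2
    cases a with
    | none =>
      cases b with
      | none => rfl
      | some w => exact h2.elim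
    | some v =>
      cases b with
      | none => exact h1.elim
      | some w => exact congrArg some (M.le_antisymm h1 h2)
  Dom := E.Dom'
  dne := fun a => by cases a with
    | none => exact E.rdne
    | some v => exact M.dne v
  tr := fun {a b} h x => E.tr' h x
  tr_refl := by
    intro a h x
    cases a with
    | none => rfl
    | some v => exact M.tr_refl v h x
  tr_trans := by
    intro a b c h1 h2 h3 x
    cases a with
    | none =>
      cases b with
      | none =>
        cases c with
        | none => rfl
        | some u => rfl
      | some w =>
        cases c with
        | none => exact h2.elim
        | some u => exact E.rtr_compat h2 x
    | some v =>
      cases b with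
      | none => exact h1.elim
      | some w =>
        cases c with
        | none => exact h2.elim
        | some u => exact M.tr_trans h1 h2 h3 x
  mem := E.mem'
  mem_mono := by
    intro a b h x y hxy
    cases a with
    | none =>
      cases b with
      | none => exact hxy
      | some w => exact E.rmem_mono w x y hxy
    | some v =>
      cases b with
      | none => exact h.elim
      | some w => exact M.mem_mono h x y hxy

end RootExtension

/-- `Δ` is `Γ`-extensible: every Kripke model of set theory forcing `Γ ∪ Δ` can be extended,
by adding a new root, to a model (based on the extended frame and restricting to the original
model) that forces `Δ`. -/
def GammaExtensible (Γ Δ : Set ZFForm) : Prop :=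
  ∀ M : SetKripkeModel, (∀ φ ∈ Γ ∪ Δ, Forces M φ) →
    ∃ E : RootExtension M, ∀ φ ∈ Δ, Forces E.toModel φ

/-- `Δ` is extensible: it is `∅`-extensible. -/
def Extensible (Δ : Set ZFForm) : Prop := GammaExtensible ∅ Δ

/-! ## Renaming of variables and bounded formulas -/

namespace ZFForm

/-- Rename the free occurrences of the variable `x` to `y`. -/
def renameFree (x y : ℕ) : ZFForm → ZFForm
  | .mem i j => .mem (if i = x then y else i) (if j = x then y else j)
  | .eq i j => .eq (if i = x then y else i) (if j = x then y else j)
  | .bot => .bot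
  | .top => .top
  | .and A B => .and (A.renameFree x y) (B.renameFree x y)
  | .or A B => .or (A.renameFree x y) (B.renameFree x y)
  | .imp A B => .imp (A.renameFree x y) (B.renameFree x y)
  | .all z A => if z = x then .all z A else .all z (A.renameFree x y)
  | .ex z A => if z = x then .ex z A else .ex z (A.renameFree x y)

/-- `y` is free for (substitutable for) `x`: no free occurrence of `x` lies in the scope of a
quantifier binding `y`. -/
def freeFor (y x : ℕ) : ZFForm → Prop
  | .mem _ _ => True
  | .eq _ _ => True
  | .bot => True
  | .top => True
  | .and A B => freeFor y x A ∧ freeFor y x B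
  | .or A B => freeFor y x A ∧ freeFor y x B
  | .imp A B => freeFor y x A ∧ freeFor y x B
  | .all z A => x ∉ (ZFForm.all z A).FV ∨ (y ≠ z ∧ freeFor y x A)
  | .ex z A => x ∉ (ZFForm.ex z A).FV ∨ (y ≠ z ∧ freeFor y x A)

end ZFForm

/-- The `Δ₀` (bounded) formulas: all quantifiers are bounded. -/
inductive IsDelta0 : ZFForm → Prop
  | mem (i j : ℕ) : IsDelta0 (.mem i j)
  | eq (i j : ℕ) : IsDelta0 (.eq i j)
  | bot : IsDelta0 .bot
  | top : IsDelta0 .top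
  | and {A B : ZFForm} : IsDelta0 A → IsDelta0 B → IsDelta0 (A.and B)
  | or {A B : ZFForm} : IsDelta0 A → IsDelta0 B → IsDelta0 (A.or B)
  | imp {A B : ZFForm} : IsDelta0 A → IsDelta0 B → IsDelta0 (A.imp B)
  | ball {x y : ℕ} {A : ZFForm} : x ≠ y → IsDelta0 A →
      IsDelta0 (.all x ((ZFForm.mem x y).imp A))
  | bex {x y : ℕ} {A : ZFForm} : x ≠ y → IsDelta0 A →
      IsDelta0 (.ex x ((ZFForm.mem x y).and A))

/-! ## Provability for set theories, over intuitionistic first-order logic with equality -/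

/-- Hilbert-style derivability in intuitionistic first-order logic (in the language of set
theory) from the set of axioms `Ax`, with modus ponens and generalisation. -/
inductive ZFProv (Ax : Set ZFForm) : ZFForm → Prop
  | axm {A : ZFForm} : A ∈ Ax → ZFProv Ax A
  | k {A B : ZFForm} : ZFProv Ax (A.imp (B.imp A))
  | s {A B C : ZFForm} : ZFProv Ax ((A.imp (B.imp C)).imp ((A.imp B).imp (A.imp C)))
  | andI {A B : ZFForm} : ZFProv Ax (A.imp (B.imp (A.and B)))
  | andE1 {A B : ZFForm} : ZFProv Ax ((A.and B).imp A)
  | andE2 {A B : ZFForm} : ZFProv Ax ((A.and B).imp B)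
  | orI1 {A B : ZFForm} : ZFProv Ax (A.imp (A.or B))
  | orI2 {A B : ZFForm} : ZFProv Ax (B.imp (A.or B))
  | orE {A B C : ZFForm} : ZFProv Ax ((A.imp C).imp ((B.imp C).imp ((A.or B).imp C)))
  | botE {A : ZFForm} : ZFProv Ax (ZFForm.bot.imp A)
  | topI : ZFProv Ax .top
  | allE {x y : ℕ} {A : ZFForm} : A.freeFor y x →
      ZFProv Ax ((ZFForm.all x A).imp (A.renameFree x y))
  | exI {x y : ℕ} {A : ZFForm} : A.freeFor y x →
      ZFProv Ax ((A.renameFree x y).imp (.ex x A))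
  | allShift {x : ℕ} {A B : ZFForm} : x ∉ A.FV →
      ZFProv Ax ((ZFForm.all x (A.imp B)).imp (A.imp (.all x B)))
  | exShift {x : ℕ} {A B : ZFForm} : x ∉ B.FV →
      ZFProv Ax ((ZFForm.all x (A.imp B)).imp ((ZFForm.ex x A).imp B))
  | mp {A B : ZFForm} : ZFProv Ax (A.imp B) → ZFProv Ax A → ZFProv Ax B
  | gen {x : ℕ} {A : ZFForm} : ZFProv Ax A → ZFProv Ax (.all x A)

/-- The axioms of equality in the language of set theory. -/
def zfEqAxioms : Set ZFForm :=
  {A | (∃ i, A = ZFForm.eq i i) ∨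
       (∃ i j, A = (ZFForm.eq i j).imp (.eq j i)) ∨
       (∃ i j k, A = (ZFForm.eq i j).imp ((ZFForm.eq j k).imp (.eq i k))) ∨
       (∃ i j k, A = (ZFForm.eq i j).imp ((ZFForm.mem i k).imp (.mem j k))) ∨
       (∃ i j k, A = (ZFForm.eq i j).imp ((ZFForm.mem k i).imp (.mem k j)))}

/-- `T ⊢ φ`: provability in the set theory `T` over intuitionistic first-order logic
with equality. -/
def thyProv (T : Set ZFForm) (φ : ZFForm) : Prop := ZFProv (T ∪ zfEqAxioms) φ

/-! ## Free variables, renaming and substitution -/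

namespace ZFForm

theorem renameFree_eq_self {x y : ℕ} {A : ZFForm} (h : x ∉ A.FV) : A.renameFree x y = A := by
  induction A with
  | mem i j => simp_all [FV, renameFree, eq_comm]
  | eq i j => simp_all [FV, renameFree, eq_comm]
  | bot => rfl
  | top => rfl
  | and A B ihA ihB => simp_all [FV, renameFree]
  | or A B ihA ihB => simp_all [FV, renameFree]
  | imp A B ihA ihB => simp_all [FV, renameFree]
  | all z A ih =>
    by_cases hz : z = x
    · simp [renameFree, hz]
    · simp only [FV, Finset.mem_erase, not_and] at h
      simp [renameFree, hz, ih (h (Ne.symm hz))]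
  | ex z A ih =>
    by_cases hz : z = x
    · simp [renameFree, hz]
    · simp only [FV, Finset.mem_erase, not_and] at h
      simp [renameFree, hz, ih (h (Ne.symm hz))]

theorem renameFree_self (x : ℕ) (A : ZFForm) : A.renameFree x x = A := by
  induction A <;> simp_all [renameFree]

theorem freeFor_self (x : ℕ) (A : ZFForm) : A.freeFor x x := by
  induction A with
  | all z A ih => by_cases hz : x = z <;> simp_all [freeFor, FV]
  | ex z A ih => by_cases hz : x = z <;> simp_all [freeFor, FV]
  | _ => simp_all [freeFor]

theorem freeFor_of_notMem {x y : ℕ} {A : ZFForm} (h : x ∉ A.FV) : A.freeFor y x := by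
  induction A with
  | and A B ihA ihB => simp_all [FV, freeFor]
  | or A B ihA ihB => simp_all [FV, freeFor]
  | imp A B ihA ihB => simp_all [FV, freeFor]
  | all z A ih => exact Or.inl h
  | ex z A ih => exact Or.inl h
  | _ => trivial

theorem mem_FV_renameFree {x y z : ℕ} {A : ZFForm} (h : z ∈ (A.renameFree x y).FV) :
    (z ∈ A.FV ∧ z ≠ x) ∨ z = y := by
  induction A with
  | mem i j => simp only [renameFree, FV, Finset.mem_insert, Finset.mem_singleton] at *; grind
  | eq i j => simp only [renameFree, FV, Finset.mem_insert, Finset.mem_singleton] at *; grind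
  | bot => simp [renameFree, FV] at h
  | top => simp [renameFree, FV] at h
  | and A B ihA ihB => simp only [renameFree, FV, Finset.mem_union] at *; grind
  | or A B ihA ihB => simp only [renameFree, FV, Finset.mem_union] at *; grind
  | imp A B ihA ihB => simp only [renameFree, FV, Finset.mem_union] at *; grind
  | all w A ih =>
    by_cases hw : w = x <;> simp only [renameFree, hw, if_true, if_false, FV, Finset.mem_erase] at *
      <;> grind
  | ex w A ih =>
    by_cases hw : w = x <;> simp only [renameFree, hw, if_true, if_false, FV, Finset.mem_erase] at *
      <;> grind

/-- Renaming `x` to a variable `c` that is not free can be undone. -/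
theorem renameFree_renameFree {x c : ℕ} {A : ZFForm} (hc : c ∉ A.FV) (hf : A.freeFor c x) :
    (A.renameFree x c).renameFree c x = A ∧ (A.renameFree x c).freeFor x c := by
  induction A with
  | mem i j =>
    simp only [renameFree, freeFor, FV, Finset.mem_insert, Finset.mem_singleton] at *; grind
  | eq i j =>
    simp only [renameFree, freeFor, FV, Finset.mem_insert, Finset.mem_singleton] at *; grind
  | bot => simp [renameFree, freeFor]
  | top => simp [renameFree, freeFor]
  | and A B ihA ihB => simp_all [renameFree, freeFor, FV]
  | or A B ihA ihB => simp_all [renameFree, freeFor, FV]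
  | imp A B ihA ihB => simp_all [renameFree, freeFor, FV]
  | all w A ih =>
    by_cases hx : x ∈ (ZFForm.all w A).FV
    · have hf' := hf.resolve_left (not_not.2 hx)
      have hw : w ≠ x := by rintro rfl; simp [FV] at hx
      have hc' : c ∉ A.FV := fun h => hc (by simp [FV, h, hf'.1])
      obtain ⟨h1, h2⟩ := ih hc' hf'.2
      simp only [renameFree, if_neg hw, if_neg hf'.1.symm, h1, true_and]
      exact Or.inr ⟨hw.symm, h2⟩
    · rw [renameFree_eq_self hx]
      exact ⟨renameFree_eq_self hc, freeFor_of_notMem hc⟩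
  | ex w A ih =>
    by_cases hx : x ∈ (ZFForm.ex w A).FV
    · have hf' := hf.resolve_left (not_not.2 hx)
      have hw : w ≠ x := by rintro rfl; simp [FV] at hx
      have hc' : c ∉ A.FV := fun h => hc (by simp [FV, h, hf'.1])
      obtain ⟨h1, h2⟩ := ih hc' hf'.2
      simp only [renameFree, if_neg hw, if_neg hf'.1.symm, h1, true_and]
      exact Or.inr ⟨hw.symm, h2⟩
    · rw [renameFree_eq_self hx]
      exact ⟨renameFree_eq_self hc, freeFor_of_notMem hc⟩

theorem exists_fresh_bound (A : ZFForm) :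
    ∃ N, ∀ y, N ≤ y → y ∉ A.FV ∧ ∀ x, A.freeFor y x := by
  induction A with
  | mem i j => exact ⟨i + j + 1, fun y hy => ⟨by simp [FV]; omega, fun _ => trivial⟩⟩
  | eq i j => exact ⟨i + j + 1, fun y hy => ⟨by simp [FV]; omega, fun _ => trivial⟩⟩
  | bot => exact ⟨0, fun y hy => ⟨by simp [FV], fun _ => trivial⟩⟩
  | top => exact ⟨0, fun y hy => ⟨by simp [FV], fun _ => trivial⟩⟩
  | and A B ihA ihB | or A B ihA ihB | imp A B ihA ihB =>
    obtain ⟨N, hN⟩ := ihA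
    obtain ⟨M, hM⟩ := ihB
    refine ⟨N + M, fun y hy => ?_⟩
    have h1 := hN y (by omega)
    have h2 := hM y (by omega)
    exact ⟨by simp [FV, h1.1, h2.1], fun x => ⟨h1.2 x, h2.2 x⟩⟩
  | all z A ih | ex z A ih =>
    obtain ⟨N, hN⟩ := ih
    refine ⟨N + z + 1, fun y hy => ?_⟩
    have h1 := hN y (by omega)
    exact ⟨by simp [FV, h1.1], fun x => Or.inr ⟨by omega, h1.2 x⟩⟩

/-- Apply `f` to all variables, free and bound. -/
def map (f : ℕ → ℕ) : ZFForm → ZFForm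
  | .mem i j => .mem (f i) (f j)
  | .eq i j => .eq (f i) (f j)
  | .bot => .bot
  | .top => .top
  | .and A B => .and (A.map f) (B.map f)
  | .or A B => .or (A.map f) (B.map f)
  | .imp A B => .imp (A.map f) (B.map f)
  | .all x A => .all (f x) (A.map f)
  | .ex x A => .ex (f x) (A.map f)

theorem map_map (f g : ℕ → ℕ) (A : ZFForm) : (A.map f).map g = A.map (g ∘ f) := by
  induction A <;> simp_all [map]

theorem map_id (A : ZFForm) : A.map id = A := by
  induction A <;> simp_all [map]

theorem exists_map_congr_bound (A : ZFForm) :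
    ∃ N, ∀ f g : ℕ → ℕ, (∀ x < N, f x = g x) → A.map f = A.map g := by
  induction A with
  | mem i j =>
    exact ⟨i + j + 1, fun f g h => by simp [map, h i (by omega), h j (by omega)]⟩
  | eq i j =>
    exact ⟨i + j + 1, fun f g h => by simp [map, h i (by omega), h j (by omega)]⟩
  | bot => exact ⟨0, fun _ _ _ => rfl⟩
  | top => exact ⟨0, fun _ _ _ => rfl⟩
  | and A B ihA ihB | or A B ihA ihB | imp A B ihA ihB =>
    obtain ⟨N, hN⟩ := ihA
    obtain ⟨M, hM⟩ := ihB
    exact ⟨N + M, fun f g h => by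
      simp [map, hN f g fun x hx => h x (by omega), hM f g fun x hx => h x (by omega)]⟩
  | all z A ih | ex z A ih =>
    obtain ⟨N, hN⟩ := ih
    exact ⟨N + z + 1, fun f g h => by
      simp [map, hN f g fun x hx => h x (by omega), h z (by omega)]⟩

theorem FV_map {f : ℕ → ℕ} (hf : f.Injective) (A : ZFForm) : (A.map f).FV = A.FV.image f := by
  induction A with
  | all z A ih => simp [map, FV, ih, Finset.image_erase hf]
  | ex z A ih => simp [map, FV, ih, Finset.image_erase hf]
  | _ => simp_all [map, FV, Finset.image_union]

theorem map_renameFree {f : ℕ → ℕ} (hf : f.Injective) (x y : ℕ) (A : ZFForm) :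
    (A.renameFree x y).map f = (A.map f).renameFree (f x) (f y) := by
  induction A with
  | mem i j => simp [map, renameFree, hf.eq_iff, apply_ite f]
  | eq i j => simp [map, renameFree, hf.eq_iff, apply_ite f]
  | all z A ih => by_cases hz : z = x <;> simp [map, renameFree, hf.eq_iff, ih, hz]
  | ex z A ih => by_cases hz : z = x <;> simp [map, renameFree, hf.eq_iff, ih, hz]
  | _ => simp_all [map, renameFree]

theorem freeFor_map {f : ℕ → ℕ} (hf : f.Injective) {x y : ℕ} {A : ZFForm} (h : A.freeFor y x) :
    (A.map f).freeFor (f y) (f x) := by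
  induction A with
  | all z A ih | ex z A ih =>
    refine h.imp (fun h => ?_) (fun h => ⟨hf.ne h.1, ih h.2⟩)
    rw [← map, FV_map hf]
    simpa [hf.eq_iff] using h
  | _ => simp_all [map, freeFor]

/-- Substitute `σ` for the free variables, replacing every bound variable `x` by `2 * x`. -/
def inst (σ : ℕ → ℕ) : ZFForm → ZFForm
  | .mem i j => .mem (σ i) (σ j)
  | .eq i j => .eq (σ i) (σ j)
  | .bot => .bot
  | .top => .top
  | .and A B => .and (A.inst σ) (B.inst σ)
  | .or A B => .or (A.inst σ) (B.inst σ)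
  | .imp A B => .imp (A.inst σ) (B.inst σ)
  | .all x A => .all (2 * x) (A.inst (Function.update σ x (2 * x)))
  | .ex x A => .ex (2 * x) (A.inst (Function.update σ x (2 * x)))

theorem inst_congr {σ τ : ℕ → ℕ} {A : ZFForm} (h : ∀ x ∈ A.FV, σ x = τ x) :
    A.inst σ = A.inst τ := by
  induction A generalizing σ τ with
  | all x A ih | ex x A ih =>
    simp only [inst]
    rw [ih]
    intro y hy
    by_cases hyx : y = x
    · simp [hyx]
    · simpa [hyx] using h y (by simp [FV, hy, hyx])
  | mem i j => simp_all [inst, FV]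
  | eq i j => simp_all [inst, FV]
  | bot => rfl
  | top => rfl
  | and A B ihA ihB | or A B ihA ihB | imp A B ihA ihB =>
    simp only [inst]
    rw [ihA fun x hx => h x (by simp [FV, hx]), ihB fun x hx => h x (by simp [FV, hx])]

theorem inst_two_mul (A : ZFForm) : A.inst (2 * ·) = A.map (2 * ·) := by
  induction A with
  | all x A ih =>
    simp [inst, map, ih]
  | ex x A ih =>
    simp [inst, map, ih]
  | _ => simp_all [inst, map]

theorem IsSentence.inst_eq_map {A : ZFForm} (hA : A.IsSentence) (σ : ℕ → ℕ) :
    A.inst σ = A.map (2 * ·) := by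
  rw [← inst_two_mul]
  exact inst_congr fun x hx => by simp [show A.FV = ∅ from hA] at hx

theorem mem_FV_inst {σ : ℕ → ℕ} {A : ZFForm} {x : ℕ} (h : x ∈ (A.inst σ).FV) :
    ∃ y ∈ A.FV, σ y = x := by
  induction A generalizing σ with
  | all z A ih | ex z A ih =>
    simp only [inst, FV, Finset.mem_erase] at h ⊢
    obtain ⟨y, hy, e⟩ := ih h.2
    have hyz : y ≠ z := by rintro rfl; simp at e; exact h.1 e.symm
    exact ⟨y, ⟨hyz, hy⟩, by simpa [hyz] using e⟩
  | mem i j => simp_all [inst, FV, eq_comm]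
  | eq i j => simp_all [inst, FV, eq_comm]
  | bot => simp [inst, FV] at h
  | top => simp [inst, FV] at h
  | and A B ihA ihB | or A B ihA ihB | imp A B ihA ihB =>
    simp only [inst, FV, Finset.mem_union] at h ⊢
    rcases h with h | h
    · obtain ⟨y, hy, e⟩ := ihA h
      exact ⟨y, Or.inl hy, e⟩
    · obtain ⟨y, hy, e⟩ := ihB h
      exact ⟨y, Or.inr hy, e⟩

theorem freeFor_inst {c : ℕ} (hc : Odd c) (z : ℕ) (σ : ℕ → ℕ) (A : ZFForm) :
    (A.inst σ).freeFor c z := by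
  induction A generalizing σ with
  | all x A ih | ex x A ih =>
    exact Or.inr ⟨by rintro rfl; exact absurd hc (by simp), ih _⟩
  | _ => simp_all [inst, freeFor]

theorem renameFree_inst {z c : ℕ} {σ : ℕ → ℕ} (hσ : ∀ y, σ y = 2 * y ∨ Odd (σ y)) (A : ZFForm) :
    (A.inst σ).renameFree z c = A.inst (fun y => if σ y = z then c else σ y) := by
  induction A generalizing σ with
  | all x A ih | ex x A ih =>
    have hσ' : ∀ y, Function.update σ x (2 * x) y = 2 * y ∨
        Odd (Function.update σ x (2 * x) y) := by
      intro y
      by_cases hy : y = x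
      · subst hy; simp
      · simpa [hy] using hσ y
    simp only [inst, renameFree]
    by_cases hx : 2 * x = z
    · rw [if_pos hx]
      congr 2
      funext y
      by_cases hy : y = x
      · subst hy; simp
      · have : σ y ≠ z := by
          rcases hσ y with h | ⟨k, h⟩ <;> omega
        simp [hy, this]
    · rw [if_neg hx, ih hσ']
      congr 2
      funext y
      by_cases hy : y = x
      · subst hy; simp [hx]
      · simp [hy]
  | _ => simp_all [inst, renameFree]

theorem renameFree_inst_update {x c : ℕ} {σ : ℕ → ℕ} (hσ : ∀ y, Odd (σ y)) (A : ZFForm) :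
    (A.inst (Function.update σ x (2 * x))).renameFree (2 * x) c =
      A.inst (Function.update σ x c) := by
  rw [renameFree_inst]
  · congr 1
    funext y
    by_cases hy : y = x
    · subst hy; simp
    · have : σ y ≠ 2 * x := by
        obtain ⟨k, h⟩ := hσ y
        omega
      simp [hy, this]
  · intro y
    by_cases hy : y = x
    · subst hy; simp
    · simp [hy, hσ y]

/-- An injective numbering of the formulas. -/
def code : ZFForm → ℕ
  | .mem i j => Nat.pair 0 (Nat.pair i j)
  | .eq i j => Nat.pair 1 (Nat.pair i j)
  | .bot => Nat.pair 2 0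
  | .top => Nat.pair 3 0
  | .and A B => Nat.pair 4 (Nat.pair A.code B.code)
  | .or A B => Nat.pair 5 (Nat.pair A.code B.code)
  | .imp A B => Nat.pair 6 (Nat.pair A.code B.code)
  | .all x A => Nat.pair 7 (Nat.pair x A.code)
  | .ex x A => Nat.pair 8 (Nat.pair x A.code)

theorem code_injective : Function.Injective code := by
  intro A
  induction A with
  | and A B ihA ihB | or A B ihA ihB | imp A B ihA ihB =>
    intro C h
    cases C <;> simp [code, Nat.pair_eq_pair] at h
    rw [ihA h.1, ihB h.2]
  | all x A ih | ex x A ih =>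
    intro C h
    cases C <;> simp [code, Nat.pair_eq_pair] at h
    rw [h.1, ih h.2]
  | _ =>
    intro C h
    cases C <;> simp_all [code, Nat.pair_eq_pair]

instance : Countable ZFForm := code_injective.countable

end ZFForm

/-! ## Soundness of the Kripke semantics -/

section Soundness

variable {M : SetKripkeModel}

theorem SetKripkeModel.tr_update {v w : M.World} (h : M.le v w) (ρ : ℕ → M.Dom v) (x : ℕ)
    (d : M.Dom v) : (fun n => M.tr h (Function.update ρ x d n)) =
      Function.update (fun n => M.tr h (ρ n)) x (M.tr h d) := by
  funext n
  by_cases hn : n = x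
  · subst hn; simp
  · simp [hn]

theorem zforce_mono {A : ZFForm} {v w : M.World} (h : M.le v w) {ρ : ℕ → M.Dom v}
    (hA : zforce M A v ρ) : zforce M A w (fun n => M.tr h (ρ n)) := by
  induction A generalizing v w with
  | mem i j => exact M.mem_mono h _ _ hA
  | eq i j => exact congrArg (M.tr h) hA
  | bot => exact hA
  | top => trivial
  | and A B ihA ihB => exact ⟨ihA h hA.1, ihB h hA.2⟩
  | or A B ihA ihB => exact hA.imp (ihA h) (ihB h)
  | imp A B ihA ihB =>
    intro u hu
    simp only [M.tr_trans h hu (M.le_trans h hu)]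
    exact hA u _
  | all x A ih =>
    intro u hu
    simp only [M.tr_trans h hu (M.le_trans h hu)]
    exact hA u _
  | ex x A ih =>
    obtain ⟨d, hd⟩ := hA
    refine ⟨M.tr h d, ?_⟩
    rw [← M.tr_update]
    exact ih h hd

theorem zforce_congr {A : ZFForm} {v : M.World} {ρ τ : ℕ → M.Dom v}
    (h : ∀ x ∈ A.FV, ρ x = τ x) : zforce M A v ρ ↔ zforce M A v τ := by
  induction A generalizing v with
  | mem i j => simp_all [zforce, ZFForm.FV]
  | eq i j => simp_all [zforce, ZFForm.FV]
  | bot => rfl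
  | top => rfl
  | and A B ihA ihB =>
    exact and_congr (ihA fun x hx => h x (by simp [ZFForm.FV, hx]))
      (ihB fun x hx => h x (by simp [ZFForm.FV, hx]))
  | or A B ihA ihB =>
    exact or_congr (ihA fun x hx => h x (by simp [ZFForm.FV, hx]))
      (ihB fun x hx => h x (by simp [ZFForm.FV, hx]))
  | imp A B ihA ihB =>
    exact forall₂_congr fun w hw => imp_congr
      (ihA fun x hx => by rw [h x (by simp [ZFForm.FV, hx])])
      (ihB fun x hx => by rw [h x (by simp [ZFForm.FV, hx])])
  | all x A ih =>
    refine forall₃_congr fun w hw d => ih fun y hy => ?_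
    by_cases hyx : y = x
    · simp [hyx]
    · simp [hyx, h y (by simp [ZFForm.FV, hy, hyx])]
  | ex x A ih =>
    refine exists_congr fun d => ih fun y hy => ?_
    by_cases hyx : y = x
    · simp [hyx]
    · simp [hyx, h y (by simp [ZFForm.FV, hy, hyx])]

theorem zforce_update_of_notMem {A : ZFForm} {x : ℕ} (hx : x ∉ A.FV) {v : M.World}
    {ρ : ℕ → M.Dom v} {d : M.Dom v} :
    zforce M A v (Function.update ρ x d) ↔ zforce M A v ρ :=
  zforce_congr fun y hy => by
    have : y ≠ x := by rintro rfl; exact hx hy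
    simp [this]

theorem zforce_renameFree {A : ZFForm} {x y : ℕ} (hf : A.freeFor y x) {v : M.World}
    {ρ : ℕ → M.Dom v} :
    zforce M (A.renameFree x y) v ρ ↔ zforce M A v (Function.update ρ x (ρ y)) := by
  induction A generalizing v with
  | mem i j => simp [zforce, ZFForm.renameFree, Function.update_apply, apply_ite ρ]
  | eq i j => simp [zforce, ZFForm.renameFree, Function.update_apply, apply_ite ρ]
  | bot => rfl
  | top => rfl
  | and A B ihA ihB => exact and_congr (ihA hf.1) (ihB hf.2)
  | or A B ihA ihB => exact or_congr (ihA hf.1) (ihB hf.2)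
  | imp A B ihA ihB =>
    refine forall₂_congr fun w hw => ?_
    rw [M.tr_update]
    exact imp_congr (ihA hf.1) (ihB hf.2)
  | all z A ih =>
    by_cases hx : x ∈ (ZFForm.all z A).FV
    · have hf' := hf.resolve_left (not_not.2 hx)
      have hz : z ≠ x := by rintro rfl; simp [ZFForm.FV] at hx
      simp only [ZFForm.renameFree, if_neg hz]
      refine forall₃_congr fun w hw d => ?_
      rw [ih hf'.2, M.tr_update, Function.update_comm hz, Function.update_of_ne hf'.1]
    · rw [ZFForm.renameFree_eq_self hx, zforce_update_of_notMem hx]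
  | ex z A ih =>
    by_cases hx : x ∈ (ZFForm.ex z A).FV
    · have hf' := hf.resolve_left (not_not.2 hx)
      have hz : z ≠ x := by rintro rfl; simp [ZFForm.FV] at hx
      simp only [ZFForm.renameFree, if_neg hz]
      refine exists_congr fun d => ?_
      rw [ih hf'.2, Function.update_comm hz, Function.update_of_ne hf'.1]
    · rw [ZFForm.renameFree_eq_self hx, zforce_update_of_notMem hx]

theorem forces_of_mem_zfEqAxioms {A : ZFForm} (hA : A ∈ zfEqAxioms) : Forces M A := by
  intro v ρ
  rcases hA with ⟨i, rfl⟩ | ⟨i, j, rfl⟩ | ⟨i, j, k, rfl⟩ | ⟨i, j, k, rfl⟩ | ⟨i, j, k, rfl⟩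
  · exact rfl
  · exact fun w hw h => Eq.symm h
  · intro w hw h u hu h'
    exact (congrArg (M.tr hu) h).trans h'
  · intro w hw h u hu h'
    have e := congrArg (M.tr hu) h
    simp only [zforce] at h' ⊢
    rwa [← e]
  · intro w hw h u hu h'
    have e := congrArg (M.tr hu) h
    simp only [zforce] at h' ⊢
    rwa [← e]

theorem zforce_of_imp {A B : ZFForm} {v : M.World} {ρ : ℕ → M.Dom v}
    (hAB : zforce M (A.imp B) v ρ) (hA : zforce M A v ρ) : zforce M B v ρ := by
  have := hAB v (M.le_refl v)
  simp only [M.tr_refl] at this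
  exact this hA

theorem zforce_of_all {x : ℕ} {A : ZFForm} {v : M.World} {ρ : ℕ → M.Dom v}
    (hA : zforce M (A.all x) v ρ) (d : M.Dom v) : zforce M A v (Function.update ρ x d) := by
  have := hA v (M.le_refl v) d
  simpa only [M.tr_refl] using this

theorem ZFProv.sound {Ax : Set ZFForm} (hM : ∀ A ∈ Ax, Forces M A) {A : ZFForm}
    (h : ZFProv Ax A) : Forces M A := by
  induction h with
  | axm hA => exact hM _ hA
  | k => exact fun v ρ w hw hA u hu _ => zforce_mono hu hA
  | s =>
    intro v ρ w hw h u hu h' t ht hA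
    exact zforce_of_imp (zforce_of_imp (zforce_mono ht (zforce_mono hu h)) hA)
      (zforce_of_imp (zforce_mono ht h') hA)
  | andI => exact fun v ρ w hw hA u hu hB => ⟨zforce_mono hu hA, hB⟩
  | andE1 => exact fun v ρ w hw h => h.1
  | andE2 => exact fun v ρ w hw h => h.2
  | orI1 => exact fun v ρ w hw h => Or.inl h
  | orI2 => exact fun v ρ w hw h => Or.inr h
  | orE =>
    intro v ρ w hw h u hu h' t ht hA
    rcases hA with hA | hA
    · exact zforce_of_imp (zforce_mono ht (zforce_mono hu h)) hA
    · exact zforce_of_imp (zforce_mono ht h') hA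
  | botE => exact fun v ρ w hw h => h.elim
  | topI => exact fun v ρ => trivial
  | allE hf => exact fun v ρ w hw h => (zforce_renameFree hf).2 (zforce_of_all h _)
  | exI hf => exact fun v ρ w hw h => ⟨_, (zforce_renameFree hf).1 h⟩
  | allShift hx =>
    intro v ρ w hw h u hu hA t ht d
    exact zforce_of_imp (zforce_of_all (zforce_mono ht (zforce_mono hu h)) d)
      ((zforce_update_of_notMem hx).2 (zforce_mono ht hA))
  | exShift hx =>
    rintro v ρ w hw h u hu ⟨d, hd⟩
    exact (zforce_update_of_notMem hx).1
      (zforce_of_imp (zforce_of_all (zforce_mono hu h) d) hd)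
  | mp _ _ ih ih' => exact fun v ρ => zforce_of_imp (ih v ρ) (ih' v ρ)
  | gen _ ih => exact fun v ρ w hw d => ih w _

theorem RootExtension.zforce_some (E : RootExtension M) {A : ZFForm} {v : M.World}
    {ρ : ℕ → M.Dom v} : zforce E.toModel A (some v) ρ ↔ zforce M A v ρ := by
  induction A generalizing v with
  | mem i j => rfl
  | eq i j => rfl
  | bot => rfl
  | top => rfl
  | and A B ihA ihB => exact and_congr ihA ihB
  | or A B ihA ihB => exact or_congr ihA ihB
  | imp A B ihA ihB =>
    constructor
    · exact fun h w hw hA => ihB.1 (h (some w) hw (ihA.2 hA))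
    · rintro h (_ | w) hw hA
      · exact hw.elim
      · exact ihB.2 (h w hw (ihA.1 hA))
  | all x A ih =>
    constructor
    · exact fun h w hw d => ih.1 (h (some w) hw d)
    · rintro h (_ | w) hw d
      · exact hw.elim
      · exact ih.2 (h w hw d)
  | ex x A ih => exact exists_congr fun d => ih

end Soundness

/-! ## Derivability and renaming of bound variables -/

theorem exists_perm_eq_two_mul (N : ℕ) : ∃ π : Equiv.Perm ℕ, ∀ x < N, π x = 2 * x := by
  induction N with
  | zero => exact ⟨1, by simp⟩
  | succ N ih =>
    obtain ⟨π, hπ⟩ := ih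
    refine ⟨π.trans (Equiv.swap (π N) (2 * N)), fun x hx => ?_⟩
    rcases Nat.lt_succ_iff_lt_or_eq.1 hx with h | rfl
    · have h1 : π x ≠ π N := π.injective.ne h.ne
      have h2 : π x ≠ 2 * N := by rw [hπ x h]; omega
      simp only [Equiv.trans_apply]
      rw [Equiv.swap_apply_of_ne_of_ne h1 h2, hπ x h]
    · simp

theorem map_mem_zfEqAxioms (f : ℕ → ℕ) {A : ZFForm} (hA : A ∈ zfEqAxioms) :
    A.map f ∈ zfEqAxioms := by
  rcases hA with ⟨i, rfl⟩ | ⟨i, j, rfl⟩ | ⟨i, j, k, rfl⟩ | ⟨i, j, k, rfl⟩ | ⟨i, j, k, rfl⟩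
  · exact Or.inl ⟨_, rfl⟩
  · exact Or.inr (Or.inl ⟨_, _, rfl⟩)
  · exact Or.inr (Or.inr (Or.inl ⟨_, _, _, rfl⟩))
  · exact Or.inr (Or.inr (Or.inr (Or.inl ⟨_, _, _, rfl⟩)))
  · exact Or.inr (Or.inr (Or.inr (Or.inr ⟨_, _, _, rfl⟩)))

/-- The axioms of `T` with all variables doubled, so that the odd variables do not occur in them,
together with the axioms of equality. -/
def doubledAxioms (T : Set ZFForm) : Set ZFForm := ZFForm.map (2 * ·) '' T ∪ zfEqAxioms

theorem ZFProv.exists_bound_map_symm {T : Set ZFForm} {A : ZFForm}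
    (h : ZFProv (doubledAxioms T) A) : ∃ N, ∀ π : Equiv.Perm ℕ, (∀ x < N, π x = 2 * x) →
      thyProv T (A.map π.symm) := by
  induction h with
  | axm hA =>
    rcases hA with ⟨χ, hχ, rfl⟩ | hA
    · obtain ⟨N, hN⟩ := χ.exists_map_congr_bound
      refine ⟨N, fun π hπ => ?_⟩
      rw [← hN π (2 * ·) hπ, ZFForm.map_map, π.symm_comp_self, ZFForm.map_id]
      exact .axm (Or.inl hχ)
    · exact ⟨0, fun π _ => .axm (Or.inr (map_mem_zfEqAxioms _ hA))⟩
  | k => exact ⟨0, fun π _ => .k⟩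
  | s => exact ⟨0, fun π _ => .s⟩
  | andI => exact ⟨0, fun π _ => .andI⟩
  | andE1 => exact ⟨0, fun π _ => .andE1⟩
  | andE2 => exact ⟨0, fun π _ => .andE2⟩
  | orI1 => exact ⟨0, fun π _ => .orI1⟩
  | orI2 => exact ⟨0, fun π _ => .orI2⟩
  | orE => exact ⟨0, fun π _ => .orE⟩
  | botE => exact ⟨0, fun π _ => .botE⟩
  | topI => exact ⟨0, fun π _ => .topI⟩
  | allE hf =>
    refine ⟨0, fun π _ => ?_⟩
    simp only [ZFForm.map, ZFForm.map_renameFree π.symm.injective]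
    exact .allE (ZFForm.freeFor_map π.symm.injective hf)
  | exI hf =>
    refine ⟨0, fun π _ => ?_⟩
    simp only [ZFForm.map, ZFForm.map_renameFree π.symm.injective]
    exact .exI (ZFForm.freeFor_map π.symm.injective hf)
  | allShift hx =>
    refine ⟨0, fun π _ => .allShift ?_⟩
    simpa [ZFForm.FV_map π.symm.injective] using hx
  | exShift hx =>
    refine ⟨0, fun π _ => .exShift ?_⟩
    simpa [ZFForm.FV_map π.symm.injective] using hx
  | mp _ _ ih ih' =>
    obtain ⟨N, hN⟩ := ih
    obtain ⟨N', hN'⟩ := ih'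
    exact ⟨N + N', fun π hπ => .mp (hN π fun x hx => hπ x (by omega))
      (hN' π fun x hx => hπ x (by omega))⟩
  | gen _ ih =>
    obtain ⟨N, hN⟩ := ih
    exact ⟨N, fun π hπ => .gen (hN π hπ)⟩

theorem thyProv_of_doubled {T : Set ZFForm} {A : ZFForm}
    (h : ZFProv (doubledAxioms T) (A.map (2 * ·))) : thyProv T A := by
  obtain ⟨N, hN⟩ := h.exists_bound_map_symm
  obtain ⟨N', hN'⟩ := A.exists_map_congr_bound
  obtain ⟨π, hπ⟩ := exists_perm_eq_two_mul (N + N')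
  have := hN π fun x hx => hπ x (by omega)
  rwa [← hN' π (2 * ·) fun x hx => hπ x (by omega), ZFForm.map_map, π.symm_comp_self,
    ZFForm.map_id] at this

/-- Derivability from the hypotheses `Γ`, whose free variables are treated as parameters. -/
inductive ZFDer (Ax Γ : Set ZFForm) : ZFForm → Prop
  | prov {A : ZFForm} : ZFProv Ax A → ZFDer Ax Γ A
  | hyp {A : ZFForm} : A ∈ Γ → ZFDer Ax Γ A
  | mp {A B : ZFForm} : ZFDer Ax Γ (A.imp B) → ZFDer Ax Γ A → ZFDer Ax Γ B

namespace ZFDer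

variable {Ax Γ Δ : Set ZFForm} {A B C : ZFForm}

theorem mono (hΓ : Γ ⊆ Δ) (h : ZFDer Ax Γ A) : ZFDer Ax Δ A := by
  induction h with
  | prov h => exact .prov h
  | hyp h => exact .hyp (hΓ h)
  | mp _ _ ih ih' => exact .mp ih ih'

theorem toProv (h : ZFDer Ax ∅ A) : ZFProv Ax A := by
  induction h with
  | prov h => exact h
  | hyp h => exact h.elim
  | mp _ _ ih ih' => exact .mp ih ih'

theorem deduction (h : ZFDer Ax (insert A Γ) B) : ZFDer Ax Γ (A.imp B) := by
  induction h with
  | prov h => exact .mp (.prov .k) (.prov h)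
  | hyp h =>
    rcases h with rfl | h
    · exact .mp (.mp (.prov .s) (.prov .k)) (.prov (.k (B := .top)))
    · exact .mp (.prov .k) (.hyp h)
  | mp _ _ ih ih' => exact .mp (.mp (.prov .s) ih) ih'

theorem cut (h : ZFDer Ax Γ A) (h' : ZFDer Ax (insert A Γ) B) : ZFDer Ax Γ B :=
  .mp h'.deduction h

theorem all_elim {x : ℕ} (y : ℕ) (hf : A.freeFor y x) (h : ZFDer Ax Γ (A.all x)) :
    ZFDer Ax Γ (A.renameFree x y) :=
  .mp (.prov (.allE hf)) h

theorem all_elim_self {x : ℕ} (h : ZFDer Ax Γ (A.all x)) : ZFDer Ax Γ A := by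
  simpa [ZFForm.renameFree_self] using h.all_elim x (ZFForm.freeFor_self x A)

theorem imp_of_insert (h : ZFDer Ax {A} B) : ZFProv Ax (A.imp B) :=
  toProv (deduction (by simpa using h))

theorem gen {x : ℕ} (hx : ∀ C ∈ Γ, x ∉ C.FV) (h : ZFDer Ax Γ A) : ZFDer Ax Γ (A.all x) := by
  induction h with
  | prov h => exact .prov (.gen h)
  | hyp h =>
    exact .mp (.prov (.mp (.allShift (hx _ h)) (.gen (imp_of_insert (.hyp rfl))))) (.hyp h)
  | @mp A B _ _ ih ihb =>
    have key : ZFProv Ax (((A.imp B).all x).and (A.all x) |>.imp B) := by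
      refine imp_of_insert (.mp (A := A) (all_elim_self (x := x) ?_) (all_elim_self (x := x) ?_))
      · exact .mp (.prov .andE1) (.hyp rfl)
      · exact .mp (.prov .andE2) (.hyp rfl)
    exact .mp (.prov (.mp (.allShift (by simp [ZFForm.FV])) (.gen key)))
      (.mp (.mp (.prov .andI) ih) ihb)

/-- Generalisation on a fresh variable `c`, with the bound variable renamed to `x`. -/
theorem gen_renameFree {x c : ℕ} (hΓ : ∀ C ∈ Γ, c ∉ C.FV) (hc : c ∉ A.FV) (hf : A.freeFor c x)
    (h : ZFDer Ax Γ (A.renameFree x c)) : ZFDer Ax Γ (A.all x) := by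
  by_cases hxc : x = c
  · subst hxc
    rw [ZFForm.renameFree_self] at h
    exact h.gen hΓ
  · obtain ⟨e, hf'⟩ := ZFForm.renameFree_renameFree hc hf
    have h1 : ZFDer Ax {(A.renameFree x c).all c} (A.all x) := by
      refine gen ?_ ?_
      · rintro C rfl hx
        simp only [ZFForm.FV, Finset.mem_erase] at hx
        rcases ZFForm.mem_FV_renameFree hx.2 with h | h
        · exact h.2 rfl
        · exact hx.1 h
      · have := all_elim (Ax := Ax) x hf' (.hyp (Set.mem_singleton ((A.renameFree x c).all c)))
        rwa [e] at this
    exact .mp (.prov (imp_of_insert h1)) (h.gen hΓ)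

/-- Existential elimination with a fresh witness `c`. -/
theorem ex_elim {x c : ℕ} (hΓ : ∀ D ∈ Γ, c ∉ D.FV) (hc : c ∉ A.FV) (hf : A.freeFor c x)
    (hB : c ∉ B.FV) (hxc : x ≠ c) (hex : ZFDer Ax Γ (A.ex x))
    (h : ZFDer Ax (insert (A.renameFree x c) Γ) B) : ZFDer Ax Γ B := by
  obtain ⟨e, hf'⟩ := ZFForm.renameFree_renameFree hc hf
  have h1 : ZFProv Ax (A.imp ((A.renameFree x c).ex c)) := by
    have := ZFProv.exI (Ax := Ax) hf'
    rwa [e] at this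
  have h2 : x ∉ ((A.renameFree x c).ex c).FV := by
    intro hx
    simp only [ZFForm.FV, Finset.mem_erase] at hx
    rcases ZFForm.mem_FV_renameFree hx.2 with h | h
    · exact h.2 rfl
    · exact hx.1 h
  exact .mp (.mp (.prov (.exShift hB)) (h.deduction.gen hΓ))
    (.mp (.prov (.mp (.exShift h2) (.gen h1))) hex)

theorem or_elim (h : ZFDer Ax Γ (A.or B)) (hA : ZFDer Ax (insert A Γ) C)
    (hB : ZFDer Ax (insert B Γ) C) : ZFDer Ax Γ C :=
  .mp (.mp (.mp (.prov .orE) hA.deduction) hB.deduction) h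

theorem exists_of_iUnion {Θ : ℕ → Set ZFForm} (hΘ : Monotone Θ) (h : ZFDer Ax (⋃ k, Θ k) A) :
    ∃ k, ZFDer Ax (Θ k) A := by
  induction h with
  | prov h => exact ⟨0, .prov h⟩
  | hyp h =>
    obtain ⟨k, hk⟩ := Set.mem_iUnion.1 h
    exact ⟨k, .hyp hk⟩
  | mp _ _ ih ih' =>
    obtain ⟨k, hk⟩ := ih
    obtain ⟨l, hl⟩ := ih'
    exact ⟨max k l, .mp (hk.mono (hΘ (le_max_left k l))) (hl.mono (hΘ (le_max_right k l)))⟩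

end ZFDer

/-! ## Saturated theories -/

/-- The variables used as parameters at level `n`. They are odd, and each level adds infinitely
many of them. -/
def IsParam (n y : ℕ) : Prop := ∃ i k, i ≤ n ∧ y = 2 * Nat.pair i k + 1

theorem IsParam.odd {n y : ℕ} (h : IsParam n y) : Odd y := by
  obtain ⟨i, k, -, rfl⟩ := h
  exact ⟨_, rfl⟩

theorem IsParam.mono {n m y : ℕ} (hnm : n ≤ m) (h : IsParam n y) : IsParam m y := by
  obtain ⟨i, k, hi, rfl⟩ := h
  exact ⟨i, k, hi.trans hnm, rfl⟩

theorem exists_fresh_param (n N : ℕ) : ∃ c, IsParam (n + 1) c ∧ ¬ IsParam n c ∧ N ≤ c := by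
  refine ⟨2 * Nat.pair (n + 1) N + 1, ⟨_, _, le_rfl, rfl⟩, ?_, ?_⟩
  · rintro ⟨i, k, hi, e⟩
    have : Nat.pair (n + 1) N = Nat.pair i k := by omega
    rw [Nat.pair_eq_pair] at this
    omega
  · have := Nat.right_le_pair (n + 1) N
    omega

/-- All free variables of `A` are parameters of level `n`. -/
def ZFForm.Over (n : ℕ) (A : ZFForm) : Prop := ∀ y ∈ A.FV, IsParam n y

theorem ZFForm.Over.mono {n m : ℕ} (hnm : n ≤ m) {A : ZFForm} (h : A.Over n) : A.Over m :=
  fun y hy => (h y hy).mono hnm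

theorem ZFForm.over_inst {n : ℕ} {σ : ℕ → ℕ} (hσ : ∀ y, IsParam n (σ y)) (A : ZFForm) :
    (A.inst σ).Over n := by
  intro y hy
  obtain ⟨z, -, rfl⟩ := ZFForm.mem_FV_inst hy
  exact hσ z

/-- Prime theories with witnesses, in the language with the parameters of a given level. -/
structure SaturatedTheory (Ax : Set ZFForm) where
  level : ℕ
  carrier : Set ZFForm
  isOver : ∀ A ∈ carrier, A.Over level
  closed : ∀ A, A.Over level → ZFDer Ax carrier A → A ∈ carrier
  bot_notMem : ZFForm.bot ∉ carrier
  prime : ∀ A B, A.or B ∈ carrier → A ∈ carrier ∨ B ∈ carrier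
  witness : ∀ (x : ℕ) (A : ZFForm), A.ex x ∈ carrier → ∃ c, IsParam level c ∧ A.renameFree x c ∈ carrier

section Saturation

variable {Ax : Set ZFForm} {n : ℕ} {B : ZFForm}

/-- The sets of formulas occurring in the construction of a saturated theory of level `n + 1`
that omits `B`. -/
structure SaturationStage (Ax : Set ZFForm) (n : ℕ) (B : ZFForm) (Θ : Set ZFForm) : Prop where
  isOver : ∀ A ∈ Θ, A.Over (n + 1)
  bounded : ∃ N, ∀ A ∈ Θ, ∀ y ∈ A.FV, IsParam n y ∨ y < N
  not_der : ¬ ZFDer Ax Θ B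

theorem SaturationStage.insert_formula {Θ : Set ZFForm} (hΘ : SaturationStage Ax n B Θ) {A : ZFForm}
    (hA : A.Over (n + 1)) (hB : ¬ ZFDer Ax (insert A Θ) B) :
    SaturationStage Ax n B (insert A Θ) where
  isOver := by
    rintro C (rfl | hC)
    exacts [hA, hΘ.isOver C hC]
  bounded := by
    obtain ⟨N, hN⟩ := hΘ.bounded
    obtain ⟨N', hN'⟩ := A.exists_fresh_bound
    refine ⟨N + N', ?_⟩
    rintro C (rfl | hC) y hy
    · right
      by_contra h
      exact (hN' y (by omega)).1 hy
    · exact (hN C hC y hy).imp_right (by omega)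
  not_der := hB

theorem SaturationStage.exists_step {Θ : Set ZFForm} (hΘ : SaturationStage Ax n B Θ)
    (A : ZFForm) : ∃ Θ', SaturationStage Ax n B Θ' ∧ Θ ⊆ Θ' ∧
      (A.Over (n + 1) → A ∈ Θ' ∨ ZFDer Ax (insert A Θ') B) ∧
      ∀ (x : ℕ) (C : ZFForm), A = C.ex x → A ∈ Θ' → ∃ c, IsParam (n + 1) c ∧ C.renameFree x c ∈ Θ' := by
  by_cases hA : A.Over (n + 1) ∧ ¬ ZFDer Ax (insert A Θ) B
  · have hΘA := hΘ.insert_formula hA.1 hA.2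
    by_cases hex : ∃ x C, A = ZFForm.ex x C
    · obtain ⟨x, C, rfl⟩ := hex
      obtain ⟨N, hN⟩ := hΘA.bounded
      obtain ⟨NC, hNC⟩ := C.exists_fresh_bound
      obtain ⟨NB, hNB⟩ := B.exists_fresh_bound
      obtain ⟨c, hc, hc', hle⟩ := exists_fresh_param n (N + NC + NB + x + 1)
      have hover : (C.renameFree x c).Over (n + 1) := by
        intro y hy
        rcases ZFForm.mem_FV_renameFree hy with h | rfl
        · exact hA.1 y (by simp [ZFForm.FV, h])
        · exact hc
      refine ⟨_, hΘA.insert_formula hover fun h => hΘA.not_der ?_, ?_, ?_, ?_⟩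
      · refine ZFDer.ex_elim ?_ (hNC c (by omega)).1 ((hNC c (by omega)).2 x)
          (hNB c (by omega)).1 (by omega) (.hyp (Set.mem_insert _ _)) h
        intro D hD hcD
        rcases hN D hD c hcD with h | h
        · exact hc' h
        · omega
      · exact (Set.subset_insert _ _).trans (Set.subset_insert _ _)
      · exact fun _ => Or.inl (Set.mem_insert_of_mem _ (Set.mem_insert _ _))
      · rintro x' C' e -
        cases e
        exact ⟨c, hc, Set.mem_insert _ _⟩
    · exact ⟨_, hΘA, Set.subset_insert _ _, fun _ => Or.inl (Set.mem_insert _ _),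
        fun x C e => (hex ⟨x, C, e⟩).elim⟩
  · refine ⟨Θ, hΘ, subset_rfl, fun h => Or.inr (not_not.1 fun h' => hA ⟨h, h'⟩), ?_⟩
    intro x C _ hmem
    exact (hA ⟨hΘ.isOver A hmem, by rw [Set.insert_eq_of_mem hmem]; exact hΘ.not_der⟩).elim

theorem exists_saturatedTheory {Γ : Set ZFForm} (hΓ : ∀ A ∈ Γ, A.Over n) (hB : ¬ ZFDer Ax Γ B) :
    ∃ w : SaturatedTheory Ax, w.level = n + 1 ∧ Γ ⊆ w.carrier ∧ B ∉ w.carrier := by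
  have hΓ₀ : SaturationStage Ax n B Γ :=
    ⟨fun A hA => (hΓ A hA).mono (Nat.le_succ n), ⟨0, fun A hA y hy => Or.inl (hΓ A hA y hy)⟩, hB⟩
  have : Nonempty ZFForm := ⟨.bot⟩
  obtain ⟨e, he⟩ := exists_surjective_nat ZFForm
  choose! next hnext using fun (Θ : Set ZFForm) (A : ZFForm)
    (hΘ : SaturationStage Ax n B Θ) => hΘ.exists_step A
  let Θ : ℕ → Set ZFForm := fun k => Nat.rec Γ (fun k Θ => next Θ (e k)) k
  have hst : ∀ k, SaturationStage Ax n B (Θ k) := by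
    intro k
    induction k with
    | zero => exact hΓ₀
    | succ k ih => exact (hnext _ (e k) ih).1
  have hmono : Monotone Θ := monotone_nat_of_le_succ fun k => (hnext _ (e k) (hst k)).2.1
  have hsub : ∀ k, Θ k ⊆ ⋃ k, Θ k := Set.subset_iUnion Θ
  have hder : ¬ ZFDer Ax (⋃ k, Θ k) B := fun h => by
    obtain ⟨k, hk⟩ := h.exists_of_iUnion hmono
    exact (hst k).not_der hk
  have hmax : ∀ A : ZFForm, A.Over (n + 1) → A ∉ (⋃ k, Θ k) →
      ZFDer Ax (insert A (⋃ k, Θ k)) B := by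
    intro A hA hmem
    obtain ⟨k, rfl⟩ := he A
    rcases (hnext _ (e k) (hst k)).2.2.1 hA with h | h
    · exact (hmem (hsub (k + 1) h)).elim
    · exact h.mono (Set.insert_subset_insert (hsub (k + 1)))
  have hover : ∀ A ∈ (⋃ k, Θ k), A.Over (n + 1) := by
    intro A hA
    obtain ⟨k, hk⟩ := Set.mem_iUnion.1 hA
    exact (hst k).isOver A hk
  refine ⟨⟨n + 1, ⋃ k, Θ k, hover, ?_, ?_, ?_, ?_⟩, rfl, hsub 0, fun h => hder (.hyp h)⟩
  · intro A hA h
    by_contra hmem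
    exact hder (h.cut (hmax A hA hmem))
  · exact fun h => hder (.mp (.prov .botE) (.hyp h))
  · intro A C h
    by_contra! hmem
    have hAC := hover _ h
    exact hder (ZFDer.or_elim (.hyp h)
      (hmax A (fun y hy => hAC y (by simp [ZFForm.FV, hy])) hmem.1)
      (hmax C (fun y hy => hAC y (by simp [ZFForm.FV, hy])) hmem.2))
  · intro x C h
    obtain ⟨k, hk⟩ := he (C.ex x)
    have hstep := hnext _ (e k) (hst k)
    have hmem : e k ∈ Θ (k + 1) := by
      rcases hstep.2.2.1 (hk ▸ hover _ h) with h' | h'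
      · exact h'
      · refine (hder ?_).elim
        have := h'.mono (Set.insert_subset_insert (hsub (k + 1)))
        rwa [Set.insert_eq_of_mem (hk ▸ h)] at this
    obtain ⟨c, hc, hc'⟩ := hstep.2.2.2 x C hk hmem
    exact ⟨c, hc, hsub (k + 1) hc'⟩

end Saturation

/-! ## The canonical model -/

namespace SaturatedTheory

variable {T : Set ZFForm}

theorem eq_refl_mem (w : SaturatedTheory (doubledAxioms T)) {a : ℕ} (ha : IsParam w.level a) :
    ZFForm.eq a a ∈ w.carrier :=
  w.closed _ (by simpa [ZFForm.Over, ZFForm.FV] using ha)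
    (.prov (.axm (Or.inr (Or.inl ⟨a, rfl⟩))))

theorem eq_symm_mem (w : SaturatedTheory (doubledAxioms T)) {a b : ℕ}
    (h : ZFForm.eq a b ∈ w.carrier) : ZFForm.eq b a ∈ w.carrier :=
  w.closed _ (fun y hy => w.isOver _ h y (by simpa [ZFForm.FV, or_comm] using hy))
    (.mp (.prov (.axm (Or.inr (Or.inr (Or.inl ⟨a, b, rfl⟩))))) (.hyp h))

theorem eq_trans_mem (w : SaturatedTheory (doubledAxioms T)) {a b c : ℕ}
    (h : ZFForm.eq a b ∈ w.carrier) (h' : ZFForm.eq b c ∈ w.carrier) :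
    ZFForm.eq a c ∈ w.carrier := by
  have h1 := w.isOver _ h
  have h2 := w.isOver _ h'
  exact w.closed _ (by simp_all [ZFForm.Over, ZFForm.FV])
    (.mp (.mp (.prov (.axm (Or.inr (Or.inr (Or.inr (Or.inl ⟨a, b, c, rfl⟩)))))) (.hyp h)) (.hyp h'))

theorem mem_congr_mem (w : SaturatedTheory (doubledAxioms T)) {a a' b b' : ℕ}
    (ha : ZFForm.eq a a' ∈ w.carrier) (hb : ZFForm.eq b b' ∈ w.carrier)
    (h : ZFForm.mem a b ∈ w.carrier) : ZFForm.mem a' b' ∈ w.carrier := by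
  have h1 := w.isOver _ ha
  have h2 := w.isOver _ hb
  have h3 : ZFDer (doubledAxioms T) w.carrier (.mem a' b) :=
    .mp (.mp (.prov (.axm (Or.inr (Or.inr (Or.inr (Or.inr (Or.inl ⟨a, a', b, rfl⟩)))))))
      (.hyp ha)) (.hyp h)
  exact w.closed _ (by simp_all [ZFForm.Over, ZFForm.FV])
    (.mp (.mp (.prov (.axm (Or.inr (Or.inr (Or.inr (Or.inr (Or.inr ⟨b, b', a', rfl⟩)))))))
      (.hyp hb)) h3)

/-- The parameters of the level of `w`. -/
abbrev Param (w : SaturatedTheory (doubledAxioms T)) : Type := {y : ℕ // IsParam w.level y}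

/-- Provable equality of parameters. -/
instance paramSetoid (w : SaturatedTheory (doubledAxioms T)) : Setoid w.Param where
  r a b := ZFForm.eq a.1 b.1 ∈ w.carrier
  iseqv := ⟨fun a => w.eq_refl_mem a.2, w.eq_symm_mem, w.eq_trans_mem⟩

/-- Inclusion of saturated theories. -/
structure Le (v w : SaturatedTheory (doubledAxioms T)) : Prop where
  level_le : v.level ≤ w.level
  subset : v.carrier ⊆ w.carrier

/-- A parameter of a theory, as a parameter of a larger theory. -/
def Le.param {v w : SaturatedTheory (doubledAxioms T)} (h : v.Le w) (a : v.Param) : w.Param :=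
  ⟨a.1, a.2.mono h.level_le⟩

variable (T) in
/-- The Kripke model of all saturated theories. -/
def canonicalModel : SetKripkeModel where
  World := SaturatedTheory (doubledAxioms T)
  le := Le
  le_refl _ := ⟨le_rfl, subset_rfl⟩
  le_trans h h' := ⟨h.1.trans h'.1, h.2.trans h'.2⟩
  le_antisymm := by
    rintro ⟨n, Γ, _, _, _, _, _⟩ ⟨m, Δ, _, _, _, _, _⟩ h h'
    obtain rfl : n = m := le_antisymm h.1 h'.1
    obtain rfl : Γ = Δ := h.2.antisymm h'.2
    rfl
  Dom w := Quotient w.paramSetoid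
  dne w := ⟨Quotient.mk _ ⟨1, 0, 0, Nat.zero_le _, rfl⟩⟩
  tr h := Quotient.map h.param fun _ _ hab => h.subset hab
  tr_refl v h x := by
    induction x using Quotient.inductionOn
    rfl
  tr_trans h1 h2 h3 x := by
    induction x using Quotient.inductionOn
    rfl
  mem w x y := ∃ a b : w.Param, ⟦a⟧ = x ∧ ⟦b⟧ = y ∧ ZFForm.mem a.1 b.1 ∈ w.carrier
  mem_mono := by
    rintro v w h _ _ ⟨a, b, rfl, rfl, hab⟩
    exact ⟨h.param a, h.param b, rfl, rfl, h.subset hab⟩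

theorem mk_update (w : SaturatedTheory (doubledAxioms T)) (r : ℕ → w.Param) (x : ℕ)
    (c : w.Param) : Function.update (fun i => (⟦r i⟧ : Quotient w.paramSetoid)) x ⟦c⟧ =
      fun i => ⟦Function.update r x c i⟧ := by
  funext i
  by_cases hi : i = x
  · subst hi; simp
  · simp [hi]

theorem val_update (w : SaturatedTheory (doubledAxioms T)) (r : ℕ → w.Param) (x : ℕ)
    (c : w.Param) : (fun i => (Function.update r x c i).1) =
      Function.update (fun i => (r i).1) x c.1 := by
  funext i
  by_cases hi : i = x
  · subst hi; simp
  · simp [hi]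

theorem zforce_canonicalModel (A : ZFForm) (w : SaturatedTheory (doubledAxioms T))
    (r : ℕ → w.Param) :
    zforce (canonicalModel T) A w (fun i => (⟦r i⟧ : Quotient w.paramSetoid)) ↔
      A.inst (fun i => (r i).1) ∈ w.carrier := by
  induction A generalizing w with
  | mem i j =>
    constructor
    · rintro ⟨a, b, ha, hb, h⟩
      exact w.mem_congr_mem (Quotient.exact ha) (Quotient.exact hb) h
    · exact fun h => ⟨r i, r j, rfl, rfl, h⟩
  | eq i j => exact Quotient.eq
  | bot => exact iff_of_false id w.bot_notMem
  | top =>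
    exact iff_of_true trivial
      (w.closed _ (by simp [ZFForm.inst, ZFForm.Over, ZFForm.FV]) (.prov .topI))
  | and A B ihA ihB =>
    refine (and_congr (ihA w r) (ihB w r)).trans ⟨fun h => ?_, fun h => ⟨?_, ?_⟩⟩
    · exact w.closed _ (ZFForm.over_inst (fun i => (r i).2) (A.and B))
        (.mp (.mp (.prov .andI) (.hyp h.1)) (.hyp h.2))
    · exact w.closed _ (ZFForm.over_inst (fun i => (r i).2) A) (.mp (.prov .andE1) (.hyp h))
    · exact w.closed _ (ZFForm.over_inst (fun i => (r i).2) B) (.mp (.prov .andE2) (.hyp h))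
  | or A B ihA ihB =>
    refine (or_congr (ihA w r) (ihB w r)).trans ⟨fun h => ?_, w.prime _ _⟩
    have hover := ZFForm.over_inst (fun i => (r i).2) (A.or B)
    rcases h with h | h
    · exact w.closed _ hover (.mp (.prov .orI1) (.hyp h))
    · exact w.closed _ hover (.mp (.prov .orI2) (.hyp h))
  | imp A B ihA ihB =>
    constructor
    · intro h
      by_contra hmem
      have hder : ¬ ZFDer (doubledAxioms T)
          (insert (A.inst fun i => (r i).1) w.carrier) (B.inst fun i => (r i).1) := fun hd =>
        hmem (w.closed _ (ZFForm.over_inst (fun i => (r i).2) (A.imp B)) hd.deduction)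
      obtain ⟨u, hlev, hsub, hB⟩ := exists_saturatedTheory (n := w.level) (by
        rintro C (rfl | hC)
        exacts [ZFForm.over_inst (fun i => (r i).2) A, w.isOver C hC]) hder
      have hle : w.Le u := ⟨by omega, (Set.subset_insert _ _).trans hsub⟩
      exact hB ((ihB u fun i => hle.param (r i)).1
        (h u hle ((ihA u fun i => hle.param (r i)).2 (hsub (Set.mem_insert _ _)))))
    · rintro h (u : SaturatedTheory (doubledAxioms T)) (hle : w.Le u) hA
      have hA' := (ihA u fun i => hle.param (r i)).1 hA
      exact (ihB u fun i => hle.param (r i)).2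
        (u.closed _ (ZFForm.over_inst (fun i => (hle.param (r i)).2) B)
          (.mp (.hyp (hle.subset h)) (.hyp hA')))
  | all x A ih =>
    constructor
    · intro h
      by_contra hmem
      obtain ⟨N, hN⟩ := (A.inst (Function.update (fun i => (r i).1) x (2 * x))).exists_fresh_bound
      obtain ⟨c, hc, hc', hle⟩ := exists_fresh_param w.level N
      have hder : ¬ ZFDer (doubledAxioms T) w.carrier
          (A.inst (Function.update (fun i => (r i).1) x c)) := by
        intro hd
        rw [← ZFForm.renameFree_inst_update fun i => (r i).2.odd] at hd
        exact hmem (w.closed _ (ZFForm.over_inst (fun i => (r i).2) (A.all x))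
          (hd.gen_renameFree (fun C hC hcC => hc' (w.isOver C hC c hcC)) (hN c hle).1
            ((hN c hle).2 _)))
      obtain ⟨u, hlev, hsub, hA⟩ := exists_saturatedTheory w.isOver hder
      have hwu : w.Le u := ⟨by omega, hsub⟩
      let d : u.Param := ⟨c, hlev ▸ hc⟩
      have h1 := h u hwu (⟦d⟧ : Quotient u.paramSetoid)
      have h2 := mk_update u (fun i => hwu.param (r i)) x d
      have h3 := (ih u _).1 (h2 ▸ h1)
      rw [val_update] at h3
      exact hA h3
    · rintro h (u : SaturatedTheory (doubledAxioms T)) (hle : w.Le u) d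
      obtain ⟨c, rfl⟩ := Quotient.exists_rep d
      have h2 := mk_update u (fun i => hle.param (r i)) x c
      refine h2 ▸ (ih u _).2 ?_
      refine u.closed _ (ZFForm.over_inst (fun i => Subtype.prop _) A) ?_
      rw [val_update, ← ZFForm.renameFree_inst_update fun i => (hle.param (r i)).2.odd]
      exact ZFDer.all_elim c.1 (ZFForm.freeFor_inst c.2.odd _ _ _) (.hyp (hle.subset h))
  | ex x A ih =>
    constructor
    · rintro ⟨d, h⟩
      obtain ⟨c, rfl⟩ := Quotient.exists_rep d
      have h3 := (ih w _).1 (mk_update w r x c ▸ h)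
      rw [val_update, ← ZFForm.renameFree_inst_update fun i => (r i).2.odd] at h3
      exact w.closed _ (ZFForm.over_inst (fun i => (r i).2) (A.ex x))
        (.mp (.prov (.exI (ZFForm.freeFor_inst c.2.odd _ _ _))) (.hyp h3))
    · intro h
      obtain ⟨c, hc, h3⟩ := w.witness _ _ h
      rw [ZFForm.renameFree_inst_update fun i => (r i).2.odd] at h3
      let d : w.Param := ⟨c, hc⟩
      refine ⟨(⟦d⟧ : Quotient w.paramSetoid), ?_⟩
      refine mk_update w r x d ▸ (ih w _).2 ?_
      rw [val_update]
      exact h3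

theorem zforce_canonicalModel_sentence {A : ZFForm} (hA : A.IsSentence)
    (w : SaturatedTheory (doubledAxioms T)) (ρ : ℕ → (canonicalModel T).Dom w) :
    zforce (canonicalModel T) A w ρ ↔ A.map (2 * ·) ∈ w.carrier := by
  choose r hr using fun i => Quotient.exists_rep (ρ i)
  obtain rfl : (fun i => ⟦r i⟧) = ρ := funext hr
  rw [← hA.inst_eq_map fun i => (r i).1]
  exact zforce_canonicalModel A w r

theorem forces_canonicalModel (hT : ∀ χ ∈ T, χ.IsSentence) {χ : ZFForm} (hχ : χ ∈ T) :
    Forces (canonicalModel T) χ := by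
  intro w ρ
  refine (zforce_canonicalModel_sentence (hT χ hχ) w ρ).2 (w.closed _ ?_ ?_)
  · rw [← (hT χ hχ).inst_eq_map fun _ => 1]
    exact ZFForm.over_inst (fun _ => ⟨0, 0, Nat.zero_le _, rfl⟩) χ
  · exact .prov (.axm (Or.inl ⟨χ, hχ, rfl⟩))

/-- Completeness: an unprovable sentence fails at some world of the canonical model. -/
theorem thyProv_of_forall_zforce {A : ZFForm} (hA : A.IsSentence)
    (h : ∀ w : SaturatedTheory (doubledAxioms T), ∃ ρ, zforce (canonicalModel T) A w ρ) :
    thyProv T A := by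
  by_contra hprov
  have hder : ¬ ZFDer (doubledAxioms T) ∅ (A.map (2 * ·)) := fun hd =>
    hprov (thyProv_of_doubled hd.toProv)
  obtain ⟨w, -, -, hw⟩ := exists_saturatedTheory (n := 0) (by simp) hder
  obtain ⟨ρ, hρ⟩ := h w
  exact hw ((zforce_canonicalModel_sentence hA w ρ).1 hρ)

end SaturatedTheory

/-- If `T` is an extensible set theory (based on intuitionistic logic),
then `T` has the disjunction property: whenever `T ⊢ φ ∨ ψ`, then `T ⊢ φ` or `T ⊢ ψ`. -/
theorem disjunction_property_of_extensible (T : Set ZFForm)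
    (hsent : ∀ χ ∈ T, χ.IsSentence) (hext : Extensible T)
    (φ ψ : ZFForm) (hφ : φ.IsSentence) (hψ : ψ.IsSentence)
    (h : thyProv T (φ.or ψ)) : thyProv T φ ∨ thyProv T ψ := by
  have hM : ∀ χ ∈ (∅ ∪ T : Set ZFForm), Forces (SaturatedTheory.canonicalModel T) χ := by
    rintro χ (hχ | hχ)
    · exact hχ.elim
    · exact SaturatedTheory.forces_canonicalModel hsent hχ
  obtain ⟨E, hE⟩ := hext _ hM
  have hE' : ∀ χ ∈ T ∪ zfEqAxioms, Forces E.toModel χ := by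
    rintro χ (hχ | hχ)
    · exact hE χ hχ
    · exact forces_of_mem_zfEqAxioms hχ
  obtain ⟨d⟩ := E.rdne
  refine (ZFProv.sound hE' h none fun _ => d).imp (fun hr => ?_) (fun hr => ?_)
  · exact SaturatedTheory.thyProv_of_forall_zforce hφ fun w =>
      ⟨_, E.zforce_some.1 (zforce_mono (M := E.toModel) (v := none) (w := some w) trivial hr)⟩
  · exact SaturatedTheory.thyProv_of_forall_zforce hψ fun w =>
      ⟨_, E.zforce_some.1 (zforce_mono (M := E.toModel) (v := none) (w := some w) trivial hr)⟩
end
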